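/- arXiv:1711.06345 — 3 statements merged into one kernel-verified Lean document; each statement's English description precedes it below -/
import Mathlib

section
/- The only pair (b, v) ∈ ℚ × ℚ satisfying v² = (b − 1)(b³ + b² − b + 3) is (b, v) = (1, 0). -/
/-- The ring of Eisenstein integers. -/
abbrev EisW : Type := QuadraticAlgebra ℤ (-1) (-1)

lemma eis_norm (z : EisW) : z.norm = z.re ^ 2 - z.re * z.im + z.im ^ 2 := by
  rw [QuadraticAlgebra.norm_def]; ring

lemma eis_norm_nonneg (z : EisW) : 0 ≤ z.norm := by
  rw [eis_norm]; nlinarith [sq_nonneg (z.re - z.im), sq_nonneg z.re, sq_nonneg z.im]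

lemma eis_norm_pos {z : EisW} (hz : z ≠ 0) : 0 < z.norm := by
  rcases (eis_norm_nonneg z).lt_or_eq with h | h
  · exact h
  · exfalso
    apply hz
    rw [eis_norm] at h
    have h1 : z.re = 0 := by nlinarith [sq_nonneg (z.re - 2 * z.im), sq_nonneg z.re]
    have h2 : z.im = 0 := by rw [h1] at h; nlinarith
    ext <;> simp [h1, h2]

lemma int_round (m N : ℤ) (hN : 0 < N) : ∃ q : ℤ, -N ≤ 2 * (m - q * N) ∧ 2 * (m - q * N) ≤ N := by
  refine ⟨(2 * m + N) / (2 * N), ?_, ?_⟩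
  · have := Int.mul_ediv_add_emod (2 * m + N) (2 * N)
    have h2 := Int.emod_nonneg (2 * m + N) (b := 2 * N) (by lia)
    have h3 := Int.emod_lt_of_pos (2 * m + N) (b := 2 * N) (by lia)
    nlinarith
  · have := Int.mul_ediv_add_emod (2 * m + N) (2 * N)
    have h2 := Int.emod_nonneg (2 * m + N) (b := 2 * N) (by lia)
    have h3 := Int.emod_lt_of_pos (2 * m + N) (b := 2 * N) (by lia)
    nlinarith

lemma eis_div (x y : EisW) (hy : y ≠ 0) : ∃ q : EisW, (x - y * q).norm < y.norm := by
  have hN := eis_norm_pos hy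
  obtain ⟨q0, h1, h2⟩ := int_round (x * star y).re y.norm hN
  obtain ⟨q1, h3, h4⟩ := int_round (x * star y).im y.norm hN
  refine ⟨⟨q0, q1⟩, ?_⟩
  have key : (x - y * ⟨q0, q1⟩ : EisW).norm * y.norm =
      ((x * star y).re - q0 * y.norm) ^ 2
      - ((x * star y).re - q0 * y.norm) * ((x * star y).im - q1 * y.norm)
      + ((x * star y).im - q1 * y.norm) ^ 2 := by
    simp only [eis_norm, QuadraticAlgebra.re_mul, QuadraticAlgebra.im_mul, QuadraticAlgebra.re_star,
      QuadraticAlgebra.im_star, QuadraticAlgebra.re_sub, QuadraticAlgebra.im_sub]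
    ring
  generalize (x * star y).re - q0 * y.norm = e at *
  generalize (x * star y).im - q1 * y.norm = f at *
  have : (x - y * ⟨q0, q1⟩ : EisW).norm * y.norm < y.norm * y.norm := by
    rw [key]
    have he : 4 * e ^ 2 ≤ y.norm ^ 2 := by nlinarith
    have hf : 4 * f ^ 2 ≤ y.norm ^ 2 := by nlinarith
    nlinarith [sq_nonneg (e + f), sq_nonneg (e - f)]
  exact lt_of_mul_lt_mul_right this hN.le

noncomputable instance eisEuclid : EuclideanDomain EisW where
  quotient x y := by classical exact if h : y = 0 then 0 else (eis_div x y h).choose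
  quotient_zero a := by simp
  remainder x y := by classical exact if h : y = 0 then x else x - y * (eis_div x y h).choose
  quotient_mul_add_remainder_eq a b := by
    by_cases h : b = 0 <;> simp [h]
  r x y := x.norm.toNat < y.norm.toNat
  r_wellFounded := (measure (fun x : EisW => x.norm.toNat)).wf
  remainder_lt a b hb := by
    have h := (eis_div a b hb).choose_spec
    have := eis_norm_pos hb
    simp only [hb, dite_false]
    lia
  mul_left_not_lt a b hb := by
    have h1 := eis_norm_pos hb
    have h2 := eis_norm_nonneg a
    rw [map_mul]
    have : a.norm ≤ a.norm * b.norm := by nlinarith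
    lia

lemma eis_unit_cases {p q : ℤ} (h : p ^ 2 - p * q + q ^ 2 = 1) :
    (p = 1 ∧ q = 0) ∨ (p = -1 ∧ q = 0) ∨ (p = 0 ∧ q = 1) ∨ (p = 0 ∧ q = -1) ∨
    (p = 1 ∧ q = 1) ∨ (p = -1 ∧ q = -1) := by
  have h1 : p ≤ 1 := by nlinarith [sq_nonneg (p - 2 * q)]
  have h2 : -1 ≤ p := by nlinarith [sq_nonneg (p - 2 * q)]
  have h3 : q ≤ 1 := by nlinarith [sq_nonneg (q - 2 * p)]
  have h4 : -1 ≤ q := by nlinarith [sq_nonneg (q - 2 * p)]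
  interval_cases p <;> interval_cases q <;> simp_all

/-- Cube extraction in the Eisenstein integers, phrased over the integers. -/
lemma eis_cube (P Q m : ℤ) (hPQ : IsCoprime P Q) (h3P : ¬ (3 : ℤ) ∣ P) (h3Q : (3 : ℤ) ∣ Q)
    (h : P ^ 2 - P * Q + Q ^ 2 = m ^ 3) :
    ∃ p q : ℤ, P = p ^ 3 + q ^ 3 - 3 * p * q ^ 2 ∧ Q = 3 * (p * q * (p - q)) := by
  have hP3 : IsCoprime P 3 := ((Int.prime_three.coprime_iff_not_dvd).2 h3P).symm
  have hc : IsCoprime (P ^ 2 - P * Q + Q ^ 2) (3 * Q) := by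
    apply IsCoprime.mul_right
    · obtain ⟨k, rfl⟩ := h3Q
      have : P ^ 2 - P * (3 * k) + (3 * k) ^ 2 = P ^ 2 + 3 * (3 * k ^ 2 - P * k) := by ring
      rw [this]
      exact IsCoprime.add_mul_left_left (hP3.pow_left) _
    · have : P ^ 2 - P * Q + Q ^ 2 = P ^ 2 + Q * (Q - P) := by ring
      rw [this]
      exact IsCoprime.add_mul_left_left (hPQ.pow_left) _
  have hco : IsCoprime (⟨P, Q⟩ : EisW) (⟨P - Q, -Q⟩) := by
    obtain ⟨u, v, huv⟩ := hc
    -- 3 * Q = -(θ) * (β - β'), θ = 1 + 2ω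
    refine ⟨⟨u, 0⟩ * ⟨P - Q, -Q⟩ + ⟨v, 0⟩ * ⟨-1, -2⟩, ⟨v, 0⟩ * ⟨1, 2⟩, ?_⟩
    ext
    · rw [show (1 : EisW).re = 1 from rfl]
      simp
      linear_combination huv
    · rw [show (1 : EisW).im = 0 from rfl]
      simp
      ring
  have hmul : (⟨P, Q⟩ : EisW) * ⟨P - Q, -Q⟩ = (⟨m, 0⟩ : EisW) ^ 3 := by
    ext
    · simp [pow_succ]
      linear_combination h
    · simp [pow_succ]
      ring
  obtain ⟨d, u, hu⟩ := exists_associated_pow_of_mul_eq_pow' hco hmul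
  have hun : ((u : EisW).norm) = 1 := by
    have h1 : IsUnit ((u : EisW).norm) := (QuadraticAlgebra.isUnit_iff_norm_isUnit).1 u.isUnit
    rcases Int.isUnit_iff.1 h1 with h1 | h1
    · exact h1
    · have := eis_norm_nonneg (u : EisW); lia
  rw [eis_norm] at hun
  obtain ⟨p, q⟩ := d
  have e1 := congrArg QuadraticAlgebra.re hu
  have e2 := congrArg QuadraticAlgebra.im hu
  simp [pow_succ] at e1 e2
  generalize (u : EisW).re = a at *
  generalize (u : EisW).im = b at *
  obtain ⟨k, rfl⟩ := h3Q
  rcases eis_unit_cases hun with ⟨rfl, rfl⟩ | ⟨rfl, rfl⟩ | ⟨rfl, rfl⟩ | ⟨rfl, rfl⟩ | ⟨rfl, rfl⟩ |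
    ⟨rfl, rfl⟩
  · exact ⟨p, q, by linear_combination -e1, by linear_combination -e2⟩
  · exact ⟨-p, -q, by linear_combination -e1, by linear_combination -e2⟩
  all_goals
    exfalso
    apply h3P
  · exact ⟨-(p * q * (p - q)), by linear_combination -e1⟩
  · exact ⟨(p * q * (p - q)), by linear_combination -e1⟩
  · exact ⟨k - p * q * (p - q), by linear_combination e2 - e1⟩
  · exact ⟨k + p * q * (p - q), by linear_combination e2 - e1⟩

lemma int_coprime_of {x y : ℤ} (H : ∀ l : ℤ, Prime l → l ∣ x → l ∣ y → False) : IsCoprime x y := by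
  apply isCoprime_of_prime_dvd
  · rintro ⟨rfl, rfl⟩
    exact H 2 Int.prime_two (dvd_zero _) (dvd_zero _)
  · intro l hl h1 h2
    exact H l hl h1 h2

lemma not_both {x y l : ℤ} (h : IsCoprime x y) (hl : Prime l) (h1 : l ∣ x) (h2 : l ∣ y) : False :=
  hl.not_isUnit (h.isUnit_of_dvd' h1 h2)

lemma prime_three_of_dvd {l : ℤ} (hl : Prime l) (h : l ∣ 3) : (3 : ℤ) ∣ l :=
  ((hl.associated_of_dvd Int.prime_three h)).symm.dvd

lemma final_step (A w1 w2 w3 : ℤ) (hp : w1 * w2 * w3 = -A ^ 3)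
    (hs : w1 + w2 + w3 = -2 * A)
    (H : ∀ l : ℤ, Prime l → l ∣ A → l ∣ w1 → l ∣ w2 → l ∣ w3 → False) :
    ∃ r1 r2 r3 : ℤ, IsCoprime r1 r2 ∧ IsCoprime r2 r3 ∧ IsCoprime r3 r1 ∧
      r1 ^ 3 + r2 ^ 3 + r3 ^ 3 = 2 * r1 * r2 * r3 ∧ r1 * r2 * r3 = -A := by
  have hA : ∀ l : ℤ, Prime l → l ∣ w1 * w2 * w3 → l ∣ A := by
    intro l hl h
    rw [hp, dvd_neg] at h
    exact hl.dvd_of_dvd_pow h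
  have c12 : IsCoprime w1 w2 := int_coprime_of fun l hl h1 h2 => by
    have ha := hA l hl ((h1.mul_right _).mul_right _)
    refine H l hl ha h1 h2 ?_
    have : w3 = -2 * A - w1 - w2 := by linear_combination hs
    rw [this]
    exact dvd_sub (dvd_sub (ha.mul_left _) h1) h2
  have c23 : IsCoprime w2 w3 := int_coprime_of fun l hl h1 h2 => by
    have ha := hA l hl (h2.mul_left _)
    refine H l hl ha ?_ h1 h2
    have : w1 = -2 * A - w2 - w3 := by linear_combination hs
    rw [this]
    exact dvd_sub (dvd_sub (ha.mul_left _) h1) h2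
  have c31 : IsCoprime w3 w1 := int_coprime_of fun l hl h1 h2 => by
    have ha := hA l hl (h1.mul_left _)
    refine H l hl ha h2 ?_ h1
    have : w2 = -2 * A - w3 - w1 := by linear_combination hs
    rw [this]
    exact dvd_sub (dvd_sub (ha.mul_left _) h1) h2
  have o3 : Odd 3 := by decide
  obtain ⟨r1, rfl⟩ := Int.eq_pow_of_mul_eq_pow_odd_left (c := -A) (c12.mul_right c31.symm) o3
    (by linear_combination hp)
  obtain ⟨r2, rfl⟩ := Int.eq_pow_of_mul_eq_pow_odd_left (c := -A) (c23.mul_right c12.symm) o3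
    (by linear_combination hp)
  obtain ⟨r3, rfl⟩ := Int.eq_pow_of_mul_eq_pow_odd_left (c := -A) (c31.mul_right c23.symm) o3
    (by linear_combination hp)
  have hr : r1 * r2 * r3 = -A := by
    apply o3.strictMono_pow.injective
    change (r1 * r2 * r3) ^ 3 = (-A) ^ 3
    linear_combination hp
  refine ⟨r1, r2, r3, ?_, ?_, ?_, ?_, hr⟩
  · exact (IsCoprime.pow_iff (by norm_num) (by norm_num)).1 c12
  · exact (IsCoprime.pow_iff (by norm_num) (by norm_num)).1 c23
  · exact (IsCoprime.pow_iff (by norm_num) (by norm_num)).1 c31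
  · linear_combination hs - 2 * hr

lemma norm_cubed (p q : ℤ) : (p ^ 3 + q ^ 3 - 3 * p * q ^ 2) ^ 2
    - (p ^ 3 + q ^ 3 - 3 * p * q ^ 2) * (3 * (p * q * (p - q))) + (3 * (p * q * (p - q))) ^ 2
    = (p ^ 2 - p * q + q ^ 2) ^ 3 := by ring

/-- From `a' * N = -z³` coprime and norm shape, extract everything. -/
lemma extract (P Q a z : ℤ) (hPQ : IsCoprime P Q) (h3P : ¬ (3 : ℤ) ∣ P) (h3Q : (3 : ℤ) ∣ Q)
    (hc : IsCoprime a (P ^ 2 - P * Q + Q ^ 2))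
    (h : a * (P ^ 2 - P * Q + Q ^ 2) = -z ^ 3) :
    ∃ p q c : ℤ, P = p ^ 3 + q ^ 3 - 3 * p * q ^ 2 ∧ Q = 3 * (p * q * (p - q)) ∧ a = c ^ 3 ∧
      z = - c * (p ^ 2 - p * q + q ^ 2) ∧ IsCoprime c (p ^ 2 - p * q + q ^ 2) := by
  have o3 : Odd 3 := by decide
  obtain ⟨⟨c, hcc⟩, ⟨m, hm⟩⟩ := Int.eq_pow_of_mul_eq_pow_odd (c := -z) hc o3
    (by linear_combination h)
  obtain ⟨p, q, hP, hQ⟩ := eis_cube P Q m hPQ h3P h3Q hm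
  have hN : P ^ 2 - P * Q + Q ^ 2 = (p ^ 2 - p * q + q ^ 2) ^ 3 := by
    rw [hP, hQ]; ring
  refine ⟨p, q, c, hP, hQ, hcc, ?_, ?_⟩
  · apply o3.strictMono_pow.injective
    change z ^ 3 = (- c * (p ^ 2 - p * q + q ^ 2)) ^ 3
    rw [hN, hcc] at h
    linear_combination h
  · rw [hN, hcc] at hc
    exact (IsCoprime.pow_iff (by norm_num) (by norm_num)).1 hc

lemma mod_three_aux (p q c : ℤ) (h3 : ¬ (3 : ℤ) ∣ -c * (p ^ 2 - p * q + q ^ 2))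
    (h1 : (3 : ℤ) ∣ 2 * (-c * (p ^ 2 - p * q + q ^ 2)) - (p ^ 3 + q ^ 3)) :
    (3 : ℤ) ∣ p + q + 2 * c := by
  have key : ∀ p q c : ZMod 3, ¬ (-c * (p ^ 2 - p * q + q ^ 2) = 0) →
      2 * (-c * (p ^ 2 - p * q + q ^ 2)) - (p ^ 3 + q ^ 3) = 0 → p + q + 2 * c = 0 := by decide
  have cast3 : ∀ x : ℤ, (3 : ℤ) ∣ x ↔ (x : ZMod 3) = 0 := fun x =>
    (ZMod.intCast_zmod_eq_zero_iff_dvd x 3).symm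
  rw [cast3] at h1 h3 ⊢
  push_cast at h1 h3 ⊢
  exact key _ _ _ h3 h1

lemma case_one (X Y Z : ℤ) (hXY : IsCoprime X Y) (hZ : Z ≠ 0) (h3 : ¬ (3 : ℤ) ∣ Z)
    (hF : X ^ 3 + Y ^ 3 + Z ^ 3 = 2 * X * Y * Z) (h19 : (19 : ℤ) ∣ 3 * X + 3 * Y + 2 * Z) :
    ∃ r1 r2 r3 : ℤ, IsCoprime r1 r2 ∧ IsCoprime r2 r3 ∧ IsCoprime r3 r1 ∧
      r1 ^ 3 + r2 ^ 3 + r3 ^ 3 = 2 * r1 * r2 * r3 ∧ r1 * r2 * r3 ≠ 0 ∧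
      |r1 * r2 * r3| < |Z| := by
  obtain ⟨a, ha⟩ := h19
  have hprod : a * ((2 * Z - 3 * X) ^ 2 - (2 * Z - 3 * X) * (3 * (Y - X)) + (3 * (Y - X)) ^ 2)
      = -Z ^ 3 := by
    have : (19 : ℤ) * (a * ((2 * Z - 3 * X) ^ 2 - (2 * Z - 3 * X) * (3 * (Y - X))
      + (3 * (Y - X)) ^ 2)) = 19 * (-Z ^ 3) := by
      rw [← mul_assoc, ← ha]
      linear_combination 27 * hF
    exact mul_left_cancel₀ (by norm_num) this
  have hl3 : ∀ l : ℤ, Prime l → l ∣ Z → ¬ l ∣ 3 := fun l hl h h' =>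
    h3 ((prime_three_of_dvd hl h').trans h)
  have hlN : ∀ l : ℤ, Prime l →
      l ∣ a * ((2 * Z - 3 * X) ^ 2 - (2 * Z - 3 * X) * (3 * (Y - X)) + (3 * (Y - X)) ^ 2) →
      l ∣ Z := by
    intro l hl h
    rw [hprod, dvd_neg] at h
    exact hl.dvd_of_dvd_pow h
  have h3P : ¬ (3 : ℤ) ∣ 2 * Z - 3 * X := by lia
  have hPQ : IsCoprime (2 * Z - 3 * X) (3 * (Y - X)) := int_coprime_of fun l hl h1 h2 => by
    have hz : l ∣ Z := by
      apply hlN l hl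
      apply Dvd.dvd.mul_left
      exact dvd_add (dvd_sub (h1.pow two_ne_zero) (h1.mul_right _)) (h2.pow two_ne_zero)
    have n3 := hl3 l hl hz
    have hx : l ∣ 3 * X := by
      have : 3 * X = 2 * Z - (2 * Z - 3 * X) := by ring
      rw [this]; exact dvd_sub (hz.mul_left _) h1
    have hx := (hl.dvd_or_dvd hx).resolve_left n3
    have hy := (hl.dvd_or_dvd h2).resolve_left n3
    exact not_both hXY hl hx ((dvd_sub_left hx).1 hy)
  have hc : IsCoprime a ((2 * Z - 3 * X) ^ 2 - (2 * Z - 3 * X) * (3 * (Y - X))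
      + (3 * (Y - X)) ^ 2) := int_coprime_of fun l hl h1 h2 => by
    have hz : l ∣ Z := hlN l hl (h1.mul_right _)
    have n3 := hl3 l hl hz
    have hxy : l ∣ 3 * (X + Y) := by
      have : 3 * (X + Y) = 19 * a - 2 * Z := by linear_combination ha
      rw [this]; exact dvd_sub (h1.mul_left _) (hz.mul_left _)
    have hxy := (hl.dvd_or_dvd hxy).resolve_left n3
    have hx : l ∣ 3 * (3 * (3 * X ^ 2)) := by
      obtain ⟨z', hz'⟩ := hz
      obtain ⟨s, hs⟩ := hxy
      obtain ⟨n, hn⟩ := h2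
      have hY : Y = l * s - X := by linear_combination hs
      rw [hY, hz'] at hn
      refine ⟨n - (4 * l * z' ^ 2 - 12 * z' * X + 36 * X * 0 - 2 * z' * (3 * (l * s - 2 * X))
        + 3 * X * 3 * s + 9 * (l * s ^ 2 - 4 * s * X)), ?_⟩
      linear_combination hn
    have hx := (hl.dvd_or_dvd hx).resolve_left n3
    have hx := (hl.dvd_or_dvd hx).resolve_left n3
    have hx := hl.dvd_of_dvd_pow ((hl.dvd_or_dvd hx).resolve_left n3)
    exact not_both hXY hl hx ((dvd_add_right hx).1 hxy)
  obtain ⟨p, q, c, hP, hQ, hac, hzc, hcn⟩ := extract _ _ a Z hPQ h3P ⟨_, rfl⟩ hc hprod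
  have hc0 : c ≠ 0 := by rintro rfl; apply hZ; rw [hzc]; ring
  have rel : -6 * c * (p ^ 2 - p * q + q ^ 2) =
      2 * (p ^ 3 + q ^ 3 - 3 * p * q ^ 2) + 19 * c ^ 3 - 3 * (p * q * (p - q)) := by
    have e : 6 * Z = 2 * (p ^ 3 + q ^ 3 - 3 * p * q ^ 2) + 19 * c ^ 3 - 3 * (p * q * (p - q)) := by
      rw [← hac, ← hP, ← hQ]; linear_combination ha
    rw [hzc] at e
    linear_combination e
  have hpos : 0 ≤ p ^ 2 - p * q + q ^ 2 := by
    nlinarith [sq_nonneg (p - q), sq_nonneg p, sq_nonneg q]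
  have hn0 : p ^ 2 - p * q + q ^ 2 ≠ 0 := by intro h; apply hZ; rw [hzc, h]; ring
  have hn1 : p ^ 2 - p * q + q ^ 2 ≠ 1 := by
    intro h
    rw [h] at rel
    have hcd : c ∣ 2 := by
      rcases eis_unit_cases h with ⟨rfl, rfl⟩ | ⟨rfl, rfl⟩ | ⟨rfl, rfl⟩ | ⟨rfl, rfl⟩ | ⟨rfl, rfl⟩ |
        ⟨rfl, rfl⟩
      · exact ⟨-6 - 19 * c ^ 2, by linear_combination -rel⟩
      · exact ⟨6 + 19 * c ^ 2, by linear_combination rel⟩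
      · exact ⟨-6 - 19 * c ^ 2, by linear_combination -rel⟩
      · exact ⟨6 + 19 * c ^ 2, by linear_combination rel⟩
      · exact ⟨6 + 19 * c ^ 2, by linear_combination rel⟩
      · exact ⟨-6 - 19 * c ^ 2, by linear_combination -rel⟩
    have b1 := Int.le_of_dvd (by norm_num) hcd
    have b2 := Int.le_of_dvd (by norm_num) ((neg_dvd).2 hcd)
    have b3 : -2 ≤ c := by lia
    rcases eis_unit_cases h with ⟨rfl, rfl⟩ | ⟨rfl, rfl⟩ | ⟨rfl, rfl⟩ | ⟨rfl, rfl⟩ | ⟨rfl, rfl⟩ |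
        ⟨rfl, rfl⟩ <;> interval_cases c <;> simp_all
  -- divisibility by 3
  have h3d : (3 : ℤ) ∣ p + q + 2 * c := by
    have h1 : (3 : ℤ) ∣ 2 * Z - (p ^ 3 + q ^ 3) := ⟨X - p * q ^ 2, by linear_combination hP⟩
    rw [hzc] at h1 h3
    exact mod_three_aux p q c h3 h1
  obtain ⟨k, hk⟩ := h3d
  have hp' : p = 3 * k - q - 2 * c := by linear_combination hk
  have h3c : ¬ (3 : ℤ) ∣ c := fun h => h3 (by rw [hzc]; exact (h.neg_right).mul_right _)
  obtain ⟨r1, r2, r3, c1, c2, c3, e1, e2⟩ := final_step c (2 * k - q - 2 * c) (-k) (q - k)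
    (by
      have : (27 : ℤ) * ((2 * k - q - 2 * c) * (-k) * (q - k)) = 27 * (-c ^ 3) := by
        rw [hp'] at rel
        linear_combination -rel
      exact mul_left_cancel₀ (by norm_num) this)
    (by ring)
    (by
      intro l hl hlc h1 h2 h3'
      have hk' : l ∣ k := (dvd_neg).1 h2
      have hq : l ∣ q := (dvd_sub_left hk').1 h3'
      have hpp : l ∣ p := by
        rw [hp']
        exact dvd_sub (dvd_sub (hk'.mul_left _) hq) (hlc.mul_left _)
      exact not_both hcn hl hlc
        (dvd_add (dvd_sub (hpp.pow two_ne_zero) (hpp.mul_right _)) (hq.pow two_ne_zero)))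
  refine ⟨r1, r2, r3, c1, c2, c3, e1, by rw [e2]; simpa using hc0, ?_⟩
  rw [e2, hzc, abs_mul, abs_of_nonneg hpos, abs_neg]
  have : 0 < |c| := abs_pos.2 hc0
  have h2 : 2 ≤ p ^ 2 - p * q + q ^ 2 := by lia
  nlinarith

lemma case_two (X Y Z : ℤ) (hXY : IsCoprime X Y) (hZ : Z ≠ 0) (h3 : (3 : ℤ) ∣ Z)
    (hF : X ^ 3 + Y ^ 3 + Z ^ 3 = 2 * X * Y * Z) (h19 : (19 : ℤ) ∣ 3 * X + 3 * Y + 2 * Z) :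
    ∃ r1 r2 r3 : ℤ, IsCoprime r1 r2 ∧ IsCoprime r2 r3 ∧ IsCoprime r3 r1 ∧
      r1 ^ 3 + r2 ^ 3 + r3 ^ 3 = 2 * r1 * r2 * r3 ∧ r1 * r2 * r3 ≠ 0 ∧
      |r1 * r2 * r3| < |Z| := by
  obtain ⟨k, rfl⟩ := h3
  have hs : (3 : ℤ) ∣ X + Y := by
    have h1 : (3 : ℤ) ∣ (X + Y) ^ 3 :=
      ⟨2 * X * Y * k - 9 * k ^ 3 + X ^ 2 * Y + X * Y ^ 2, by linear_combination hF⟩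
    exact Int.prime_three.dvd_of_dvd_pow h1
  obtain ⟨s, hs⟩ := hs
  have hX : X = 3 * s - Y := by linear_combination hs
  subst hX
  have h3Y : ¬ (3 : ℤ) ∣ Y := fun h =>
    not_both hXY Int.prime_three (dvd_sub ⟨s, rfl⟩ h) h
  have hk : (3 : ℤ) ∣ k := by
    have : (3 : ℤ) ∣ Y * (Y * k) :=
      ⟨Y ^ 2 * k - 2 * s * Y * k + (Y ^ 2 * s - 3 * Y * s ^ 2 + 3 * s ^ 3 + 3 * k ^ 3), by
          have : 3 * ((3 * Y ^ 2 * s - 9 * Y * s ^ 2 + 9 * s ^ 3 + 9 * k ^ 3)) =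
             3 * (2 * (3 * s - Y) * Y * k) := by linear_combination hF
          have := mul_left_cancel₀ (by norm_num) this
          linear_combination -this⟩
    exact ((Int.prime_three.dvd_or_dvd
      ((Int.prime_three.dvd_or_dvd this).resolve_left h3Y)).resolve_left h3Y)
  obtain ⟨z, rfl⟩ := hk
  have hF' : Y ^ 2 * s - 3 * Y * s ^ 2 + 3 * s ^ 3 + 81 * z ^ 3 = 2 * (3 * s - Y) * Y * z := by
    have : 9 * (Y ^ 2 * s - 3 * Y * s ^ 2 + 3 * s ^ 3 + 81 * z ^ 3) =
      9 * (2 * (3 * s - Y) * Y * z) := by linear_combination hF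
    exact mul_left_cancel₀ (by norm_num) this
  have ht : (3 : ℤ) ∣ s + 2 * z := by
    have : (3 : ℤ) ∣ Y * (Y * (s + 2 * z)) :=
      ⟨Y * s ^ 2 - s ^ 3 - 27 * z ^ 3 + 2 * s * Y * z, by linear_combination hF'⟩
    exact ((Int.prime_three.dvd_or_dvd
      ((Int.prime_three.dvd_or_dvd this).resolve_left h3Y)).resolve_left h3Y)
  obtain ⟨j, hj⟩ := ht
  obtain ⟨t, rfl⟩ : ∃ t, j = z + t := ⟨j - z, by ring⟩
  have hs' : s = z + 3 * t := by linear_combination hj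
  subst hs'
  have hz0 : z ≠ 0 := by rintro rfl; simp at hZ
  have h19' : (19 : ℤ) ∣ z + t := by
    have : (19 : ℤ) ∣ 27 * (z + t) := by
      convert h19 using 1; ring
    lia
  obtain ⟨a, ha⟩ := h19'
  have hprod : a * ((Y - 3 * (z + t)) ^ 2 - (Y - 3 * (z + t)) * (3 * (t - z))
      + (3 * (t - z)) ^ 2) = -z ^ 3 := by
    have : (19 : ℤ) * (a * ((Y - 3 * (z + t)) ^ 2 - (Y - 3 * (z + t)) * (3 * (t - z))
      + (3 * (t - z)) ^ 2)) = 19 * (-z ^ 3) := by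
      rw [← mul_assoc, ← ha]
      have : 3 * ((z + t) * ((Y - 3 * (z + t)) ^ 2 - (Y - 3 * (z + t)) * (3 * (t - z))
        + (3 * (t - z)) ^ 2)) = 3 * (19 * (-z ^ 3)) := by
        linear_combination hF'
      exact mul_left_cancel₀ (by norm_num) this
    exact mul_left_cancel₀ (by norm_num) this
  have hlN : ∀ l : ℤ, Prime l →
      l ∣ a * ((Y - 3 * (z + t)) ^ 2 - (Y - 3 * (z + t)) * (3 * (t - z))
      + (3 * (t - z)) ^ 2) → l ∣ z := by
    intro l hl h
    rw [hprod, dvd_neg] at h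
    exact hl.dvd_of_dvd_pow h
  have hno : ∀ l : ℤ, Prime l → l ∣ z → l ∣ t → l ∣ Y → False := by
    intro l hl h1 h2 h3
    exact not_both hXY hl (dvd_sub ((dvd_add h1 (h2.mul_left _)).mul_left _) h3) h3
  have h3P : ¬ (3 : ℤ) ∣ Y - 3 * (z + t) := by lia
  have hPQ : IsCoprime (Y - 3 * (z + t)) (3 * (t - z)) := int_coprime_of fun l hl h1 h2 => by
    have hz : l ∣ z := by
      apply hlN l hl
      apply Dvd.dvd.mul_left
      exact dvd_add (dvd_sub (h1.pow two_ne_zero) (h1.mul_right _)) (h2.pow two_ne_zero)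
    have n3 : ¬ l ∣ 3 := fun h => h3P ((prime_three_of_dvd hl h).trans h1)
    have htz := (hl.dvd_or_dvd h2).resolve_left n3
    have ht : l ∣ t := (dvd_sub_left hz).1 htz
    exact hno l hl hz ht ((dvd_sub_left ((dvd_add hz ht).mul_left _)).1 h1)
  have hc : IsCoprime a ((Y - 3 * (z + t)) ^ 2 - (Y - 3 * (z + t)) * (3 * (t - z))
      + (3 * (t - z)) ^ 2) := int_coprime_of fun l hl h1 h2 => by
    have hz : l ∣ z := hlN l hl (h1.mul_right _)
    have ht : l ∣ t := by
      have : t = 19 * a - z := by linear_combination ha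
      rw [this]; exact dvd_sub (h1.mul_left _) hz
    refine hno l hl hz ht ?_
    have d1 : l ∣ 3 * (t - z) := (dvd_sub ht hz).mul_left _
    have d2 := (dvd_sub_left (d1.mul_left (Y - 3 * (z + t)))).1
      ((dvd_add_left (d1.pow two_ne_zero)).1 h2)
    exact (dvd_sub_left ((dvd_add hz ht).mul_left _)).1 (hl.dvd_of_dvd_pow d2)
  obtain ⟨p, q, c, hP, hQ, hac, hzc, hcn⟩ := extract _ _ a z hPQ h3P ⟨_, rfl⟩ hc hprod
  have hc0 : c ≠ 0 := by rintro rfl; apply hz0; rw [hzc]; ring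
  have hQ' : t - z = p * q * (p - q) := mul_left_cancel₀ (by norm_num) hQ
  have rel : 19 * c ^ 3 + 2 * c * (p ^ 2 - p * q + q ^ 2) - p * q * (p - q) = 0 := by
    rw [← hac, ← hQ']; linear_combination -ha + 2 * hzc
  have hpos : 0 ≤ p ^ 2 - p * q + q ^ 2 := by
    nlinarith [sq_nonneg (p - q), sq_nonneg p, sq_nonneg q]
  have hn0 : p ^ 2 - p * q + q ^ 2 ≠ 0 := by intro h; apply hz0; rw [hzc, h]; ring
  obtain ⟨r1, r2, r3, c1, c2, c3, e1, e2⟩ := final_step (3 * c) (q - 2 * c) (p - q - 2 * c)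
    (-p - 2 * c) (by linear_combination rel) (by ring)
    (by
      intro l hl hlc h1 h2 h3'
      by_cases n3 : l ∣ 3
      · have h3l := prime_three_of_dvd hl n3
        have d1 := h3l.trans h1
        have d3 := h3l.trans h3'
        have hpq : (3 : ℤ) ∣ p + q := by lia
        obtain ⟨w, hw⟩ := hpq
        apply h3P
        rw [hP]
        have : p = 3 * w - q := by linear_combination hw
        rw [this]
        exact ⟨9 * w ^ 3 - 9 * w ^ 2 * q + 3 * w * q ^ 2 - (3 * w - q) * q ^ 2, by ring⟩
      · have hlc := (hl.dvd_or_dvd hlc).resolve_left n3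
        have hq : l ∣ q := (dvd_sub_left (hlc.mul_left _)).1 h1
        have hpp : l ∣ p := (dvd_neg).1 ((dvd_sub_left (hlc.mul_left _)).1 h3')
        exact not_both hcn hl hlc
          (dvd_add (dvd_sub (hpp.pow two_ne_zero) (hpp.mul_right _)) (hq.pow two_ne_zero)))
  refine ⟨r1, r2, r3, c1, c2, c3, e1, by rw [e2]; simpa using hc0, ?_⟩
  rw [e2, hzc]
  have e : (3 : ℤ) * (3 * (-c * (p ^ 2 - p * q + q ^ 2))) = -(9 * c) * (p ^ 2 - p * q + q ^ 2) := by
    ring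
  rw [e, abs_mul, abs_of_nonneg hpos, abs_neg, abs_neg, abs_mul, abs_mul]
  have : 0 < |c| := abs_pos.2 hc0
  have h2 : 1 ≤ p ^ 2 - p * q + q ^ 2 := by lia
  norm_num
  nlinarith

lemma descent_step (X Y Z : ℤ) (hXY : IsCoprime X Y) (h0 : X * Y * Z ≠ 0)
    (hF : X ^ 3 + Y ^ 3 + Z ^ 3 = 2 * X * Y * Z) (h19 : (19 : ℤ) ∣ 3 * X + 3 * Y + 2 * Z) :
    ∃ r1 r2 r3 : ℤ, IsCoprime r1 r2 ∧ IsCoprime r2 r3 ∧ IsCoprime r3 r1 ∧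
      r1 ^ 3 + r2 ^ 3 + r3 ^ 3 = 2 * r1 * r2 * r3 ∧ r1 * r2 * r3 ≠ 0 ∧
      |r1 * r2 * r3| < |X * Y * Z| := by
  have hZ : Z ≠ 0 := right_ne_zero_of_mul h0
  have hxy : X * Y ≠ 0 := left_ne_zero_of_mul h0
  have hle : |Z| ≤ |X * Y * Z| := by
    rw [abs_mul (X * Y) Z]
    have := Int.one_le_abs hxy
    nlinarith [abs_nonneg Z]
  by_cases h3 : (3 : ℤ) ∣ Z
  · obtain ⟨r1, r2, r3, c1, c2, c3, e, e0, hlt⟩ := case_two X Y Z hXY hZ h3 hF h19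
    exact ⟨r1, r2, r3, c1, c2, c3, e, e0, hlt.trans_le hle⟩
  · obtain ⟨r1, r2, r3, c1, c2, c3, e, e0, hlt⟩ := case_one X Y Z hXY hZ h3 hF h19
    exact ⟨r1, r2, r3, c1, c2, c3, e, e0, hlt.trans_le hle⟩

lemma no_sol (n : ℕ) : ∀ X Y Z : ℤ, IsCoprime X Y → IsCoprime Y Z → IsCoprime Z X →
    X ^ 3 + Y ^ 3 + Z ^ 3 = 2 * X * Y * Z → X * Y * Z ≠ 0 → (X * Y * Z).natAbs = n → False := by
  induction n using Nat.strong_induction_on with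
  | _ n ih =>
    intro X Y Z hXY hYZ hZX hF h0 hn
    have h19p : Prime (19 : ℤ) := by
      rw [Int.prime_iff_natAbs_prime]; norm_num
    have hd : (19 : ℤ) ∣ (X + Y + 7 * Z) * ((X + 7 * Y + Z) * (7 * X + Y + Z)) := by
      have : (X + Y + 7 * Z) * ((X + 7 * Y + Z) * (7 * X + Y + Z)) =
          7 * (X ^ 3 + Y ^ 3 + Z ^ 3 - 2 * X * Y * Z) + 19 * (3 * (X ^ 2 * Y + X ^ 2 * Z
          + Y ^ 2 * X + Y ^ 2 * Z + Z ^ 2 * X + Z ^ 2 * Y) + 20 * X * Y * Z) := by ring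
      rw [this, hF, sub_self]
      exact ⟨_, by rw [mul_zero, zero_add]⟩
    have key : ∀ A B C : ℤ, IsCoprime A B → A * B * C = X * Y * Z →
        A ^ 3 + B ^ 3 + C ^ 3 = 2 * A * B * C → (19 : ℤ) ∣ A + B + 7 * C → False := by
      intro A B C hc hp hF' h
      obtain ⟨r1, r2, r3, c1, c2, c3, e, e0, hlt⟩ := descent_step A B C hc (by rwa [hp]) hF'
        (by lia)
      refine ih _ ?_ r1 r2 r3 c1 c2 c3 e e0 rfl
      rw [hp, Int.abs_eq_natAbs, Int.abs_eq_natAbs] at hlt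
      lia
    rcases h19p.dvd_or_dvd hd with h | h
    · exact key X Y Z hXY rfl hF h
    rcases h19p.dvd_or_dvd h with h | h
    · exact key Z X Y hZX (by ring) (by linear_combination hF) (by lia)
    · exact key Y Z X hYZ (by ring) (by linear_combination hF) (by lia)

lemma no_weier (x y : ℚ) (hx : x ≠ 0) (h : y ^ 2 + y = x ^ 3 + x ^ 2 + x) : False := by
  obtain ⟨M, D, hD, hMD, hxe⟩ : ∃ M D : ℤ, D ≠ 0 ∧ IsCoprime M D ∧ x = M / D :=
    ⟨x.num, x.den, by exact_mod_cast x.den_nz, Int.isCoprime_iff_gcd_eq_one.2 x.reduced,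
      by exact_mod_cast (Rat.num_div_den x).symm⟩
  obtain ⟨N, E, hE, hNE, hye⟩ : ∃ N E : ℤ, E ≠ 0 ∧ IsCoprime N E ∧ y = N / E :=
    ⟨y.num, y.den, by exact_mod_cast y.den_nz, Int.isCoprime_iff_gcd_eq_one.2 y.reduced,
      by exact_mod_cast (Rat.num_div_den y).symm⟩
  have hD' : (D : ℚ) ≠ 0 := by exact_mod_cast hD
  have hE' : (E : ℚ) ≠ 0 := by exact_mod_cast hE
  have hM : M ≠ 0 := by rintro rfl; apply hx; rw [hxe]; simp
  have e0 : (N * (N + E)) * D ^ 3 = (M * (M ^ 2 + D * (M + D))) * E ^ 2 := by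
    rw [hxe, hye] at h
    field_simp at h
    have h' : ((N * (N + E)) * D ^ 3 : ℚ) = (M * (M ^ 2 + D * (M + D))) * E ^ 2 := by
      linear_combination h
    exact_mod_cast h'
  have k1 : IsCoprime (E ^ 2) (N * (N + E)) := by
    apply IsCoprime.pow_left
    apply IsCoprime.mul_right hNE.symm
    have : N + E = N + E * 1 := by ring
    rw [this]
    exact IsCoprime.add_mul_left_right hNE.symm _
  have k2 : IsCoprime (D ^ 3) (M * (M ^ 2 + D * (M + D))) := by
    apply IsCoprime.pow_left
    apply IsCoprime.mul_right hMD.symm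
    exact IsCoprime.add_mul_left_right (hMD.symm.pow_right) _
  have d1 : E ^ 2 ∣ D ^ 3 := k1.dvd_of_dvd_mul_left (by rw [e0]; exact ⟨_, mul_comm _ _⟩)
  have d2 : D ^ 3 ∣ E ^ 2 := k2.dvd_of_dvd_mul_left (by rw [← e0]; exact ⟨_, mul_comm _ _⟩)
  have dDE : D ∣ E := by
    rw [← Int.pow_dvd_pow_iff (n := 2) (by norm_num)]
    exact (Dvd.intro D (by ring)).trans d2
  obtain ⟨d, rfl⟩ := dDE
  have hd0 : d ≠ 0 := right_ne_zero_of_mul hE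
  have hD2 : (D ^ 2 : ℤ) ≠ 0 := pow_ne_zero _ hD
  have f1 : d ^ 2 ∣ D := by
    rw [← mul_dvd_mul_iff_left hD2]
    rw [show D ^ 2 * d ^ 2 = (D * d) ^ 2 by ring, show D ^ 2 * D = D ^ 3 by ring]
    exact d1
  have f2 : D ∣ d ^ 2 := by
    rw [← mul_dvd_mul_iff_left hD2]
    rw [show D ^ 2 * d ^ 2 = (D * d) ^ 2 by ring, show D ^ 2 * D = D ^ 3 by ring]
    exact d2
  -- D = ± d^2
  obtain ⟨ε, hε, hDe⟩ : ∃ ε : ℤ, ε ^ 2 = 1 ∧ D = ε * d ^ 2 := by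
    rcases Int.associated_iff.1 (associated_of_dvd_dvd f2 f1) with h | h
    · exact ⟨1, by norm_num, by rw [h]; ring⟩
    · exact ⟨-1, by norm_num, by rw [h]; ring⟩
  -- normalise : M' = ε M, N' = ε N
  have hM' : IsCoprime (ε * M) d := by
    have : IsCoprime M d := by
      rw [hDe] at hMD
      exact (IsCoprime.pow_right_iff (by norm_num)).1 (hMD.of_mul_right_right)
    apply IsCoprime.mul_left _ this
    exact ⟨ε, 0, by linear_combination hε⟩
  have e1 : (ε * N - ε * M * d) * (ε * N + ε * M * d + d ^ 3) = (ε * M) ^ 3 := by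
    subst hDe
    have : ε ^ 3 * d ^ 6 * ((ε * N - ε * M * d) * (ε * N + ε * M * d + d ^ 3)) =
        ε ^ 3 * d ^ 6 * (ε * M) ^ 3 := by
      have h4 : ε ^ 4 = 1 := by rw [show ε ^ 4 = (ε ^ 2) ^ 2 by ring, hε]; norm_num
      have h3 : ε ^ 3 = ε := by rw [show ε ^ 3 = ε ^ 2 * ε by ring, hε]; ring
      have h5 : ε ^ 5 = ε := by rw [show ε ^ 5 = ε ^ 4 * ε by ring, h4]; ring
      have h6 : ε ^ 6 = 1 := by rw [show ε ^ 6 = (ε ^ 2) ^ 3 by ring, hε]; norm_num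
      ring_nf at e0 ⊢
      simp only [h3, h4, h5, h6, hε] at e0 ⊢
      linear_combination e0
    refine mul_left_cancel₀ ?_ this
    exact mul_ne_zero (pow_ne_zero _ (by rintro rfl; norm_num at hε)) (pow_ne_zero _ hd0)
  have hM0 : ε * M ≠ 0 := mul_ne_zero (by rintro rfl; norm_num at hε) hM
  generalize ε * M = m at *
  generalize ε * N = n at *
  have hco : IsCoprime (n - m * d) (n + m * d + d ^ 3) := int_coprime_of fun l hl h1 h2 => by
    have hm : l ∣ m := hl.dvd_of_dvd_pow (n := 3) (by rw [← e1]; exact h1.mul_right _)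
    have hn : l ∣ n := (dvd_sub_left (hm.mul_right _)).1 h1
    have hd : l ∣ d ^ 3 := (dvd_add_right (dvd_add hn (hm.mul_right _))).1 h2
    exact not_both hM' hl hm (hl.dvd_of_dvd_pow hd)
  have o3 : Odd 3 := by decide
  obtain ⟨⟨r, hr⟩, ⟨s, hs⟩⟩ := Int.eq_pow_of_mul_eq_pow_odd hco o3 e1
  have hrs : r * s = m := by
    apply o3.strictMono_pow.injective
    change (r * s) ^ 3 = m ^ 3
    rw [← e1, hr, hs]; ring
  rw [hr, hs] at hco
  have hco' : IsCoprime r s := (IsCoprime.pow_iff (by norm_num) (by norm_num)).1 hco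
  rw [← hrs] at hM'
  refine no_sol _ r d (-s) hM'.of_mul_left_left ?_ ?_ ?_ ?_ rfl
  · exact hM'.of_mul_left_right.symm.neg_right
  · exact hco'.symm.neg_left
  · linear_combination hs - hr + 2 * d * hrs
  · have : r * d * (-s) = -(m * d) := by rw [← hrs]; ring
    rw [this]
    exact neg_ne_zero.2 (mul_ne_zero hM0 hd0)

/-- The only rational point on the genus 1 affine curve
`v² = (b - 1)(b³ + b² - b + 3)` is `(1, 0)`. -/
theorem stmt_1 :
    {p : ℚ × ℚ | p.2 ^ 2 = (p.1 - 1) * (p.1 ^ 3 + p.1 ^ 2 - p.1 + 3)} =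
      ({(1, 0)} : Set (ℚ × ℚ)) := by
  ext ⟨b, v⟩
  simp only [Set.mem_ofPred_eq, Set.mem_singleton_iff, Prod.mk.injEq]
  constructor
  · intro h
    by_cases hb : b = 1
    · subst hb
      refine ⟨rfl, ?_⟩
      simpa using h
    · exfalso
      have hb' : b - 1 ≠ 0 := sub_ne_zero.2 hb
      obtain ⟨k, hk⟩ : ∃ k, k = b - 1 := ⟨_, rfl⟩
      have hbk : b = k + 1 := by linear_combination -hk
      subst hbk
      have hk0 : k ≠ 0 := by simpa using hb'
      refine no_weier (1 / k) ((v / k ^ 2 - 1) / 2) (by simpa using hk0) ?_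
      field_simp
      linear_combination h
  · rintro ⟨rfl, rfl⟩
    norm_num
end

section
/- The set of pairs (a, u) ∈ ℚ × ℚ satisfying u² = −3a⁴ − 16a³ − 50a² − 60a − 23 is exactly {(−1, 0), (−6/7, 19/49), (−6/7, −19/49)}. Consequently the only value a ∈ ℚ \ {0, −1, −2} for which the discriminant of the first dynatomic polynomial of φ_a is a square in ℚ is a = −6/7. -/
/-- The Eisenstein integers `ℤ[ω]`, `ω² = -1 - ω`. -/
abbrev Eis := QuadraticAlgebra ℤ (-1) (-1)

namespace Eis

/-- The norm form of the Eisenstein integers. -/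
def nm (z : Eis) : ℤ := z.re ^ 2 - z.re * z.im + z.im ^ 2

theorem nm_mul (x y : Eis) : nm (x * y) = nm x * nm y := by
  simp only [nm, QuadraticAlgebra.re_mul, QuadraticAlgebra.im_mul]; ring

theorem nm_nonneg (x : Eis) : 0 ≤ nm x := by
  unfold nm; nlinarith [sq_nonneg (x.re - x.im), sq_nonneg (x.re + x.im)]

theorem nm_pos {x : Eis} (h : x ≠ 0) : 0 < nm x := by
  rcases (nm_nonneg x).lt_or_eq with h1 | h1
  · exact h1
  · exfalso; apply h
    unfold nm at h1
    have h2 : x.re = 0 := by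
      have : x.re ^ 2 = 0 := by nlinarith [sq_nonneg (x.re - 2 * x.im), sq_nonneg x.re]
      simpa using this
    have h3 : x.im = 0 := by
      have : x.im ^ 2 = 0 := by rw [h2] at h1; linarith
      simpa using this
    ext <;> simp [h2, h3]

/-- Rounded integer quotient. -/
def rd (p n : ℤ) : ℤ := (2 * p + n) / (2 * n)

theorem rd_spec (p n : ℤ) (hn : 0 < n) :
    -n ≤ 2 * (p - n * rd p n) ∧ 2 * (p - n * rd p n) ≤ n := by
  unfold rd
  have h1 := Int.emod_add_mul_ediv (2 * p + n) (2 * n)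
  have h2 := Int.emod_nonneg (2 * p + n) (show 2 * n ≠ 0 by omega)
  have h3 := Int.emod_lt_of_pos (2 * p + n) (show 0 < 2 * n by omega)
  constructor <;> nlinarith

/-- Conjugation. -/
def cj (z : Eis) : Eis := ⟨z.re - z.im, -z.im⟩

theorem mul_cj (z : Eis) : z * cj z = ⟨nm z, 0⟩ := by
  ext
  · simp only [nm, cj, QuadraticAlgebra.re_mul]; ring
  · simp only [cj, QuadraticAlgebra.im_mul]; ring

theorem nm_cj (z : Eis) : nm (cj z) = nm z := by
  simp only [nm, cj]; ring

/-- Euclidean quotient. -/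
def quo (x y : Eis) : Eis := ⟨rd (x * cj y).re (nm y), rd (x * cj y).im (nm y)⟩

theorem nm_rem_lt (x : Eis) {y : Eis} (hy : y ≠ 0) : nm (x - y * quo x y) < nm y := by
  have hn := nm_pos hy
  have e : nm (x - y * quo x y) * nm y =
      nm (⟨(x * cj y).re - nm y * rd (x * cj y).re (nm y),
        (x * cj y).im - nm y * rd (x * cj y).im (nm y)⟩ : Eis) := by
    rw [← nm_cj y, ← nm_mul]
    congr 1
    rw [sub_mul, mul_right_comm, mul_cj, nm_cj]
    ext
    · simp [quo]
    · simp [quo]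
  obtain ⟨h1, h2⟩ := rd_spec (x * cj y).re (nm y) hn
  obtain ⟨h3, h4⟩ := rd_spec (x * cj y).im (nm y) hn
  generalize (x * cj y).re - nm y * rd (x * cj y).re (nm y) = u at *
  generalize (x * cj y).im - nm y * rd (x * cj y).im (nm y) = v at *
  simp only [nm] at e hn h1 h2 h3 h4 ⊢
  generalize y.re ^ 2 - y.re * y.im + y.im ^ 2 = n at *
  have b1 : (2 * u) ^ 2 ≤ n ^ 2 := sq_le_sq' h1 h2
  have b2 : (2 * v) ^ 2 ≤ n ^ 2 := sq_le_sq' h3 h4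
  nlinarith [sq_nonneg (u + v), sq_nonneg (u - v), sq_pos_of_pos hn]

instance instEuclid : EuclideanDomain Eis :=
  { (inferInstance : CommRing Eis), (inferInstance : Nontrivial Eis) with
    quotient := quo
    remainder := fun x y => x - y * quo x y
    quotient_zero := by
      intro a
      ext <;> simp [quo, nm, rd]
    quotient_mul_add_remainder_eq := fun _ _ => by ring
    r := _
    r_wellFounded := (measure (fun x => (nm x).natAbs)).wf
    remainder_lt := fun x y hy => by
      have := nm_rem_lt x hy
      have h2 := nm_nonneg (x - y * quo x y)
      show (nm (x - y * quo x y)).natAbs < (nm y).natAbs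
      omega
    mul_left_not_lt := fun a b hb => by
      have h1 := nm_mul a b
      have h2 := nm_nonneg a
      have h3 := nm_pos hb
      show ¬ ((nm (a * b)).natAbs < (nm a).natAbs)
      have : nm a ≤ nm (a * b) := by rw [h1]; nlinarith
      omega }

theorem cube_eq (m n : ℤ) : (⟨m, n⟩ : Eis) ^ 3 =
    ⟨m ^ 3 + n ^ 3 - 3 * m * n ^ 2, 3 * m ^ 2 * n - 3 * m * n ^ 2⟩ := by
  ext
  · simp only [pow_succ, pow_zero, one_mul, QuadraticAlgebra.mk_mul_mk]; ring
  · simp only [pow_succ, pow_zero, one_mul, QuadraticAlgebra.mk_mul_mk]; ring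

theorem unit_cases (z : Eis) (h : nm z = 1) :
    z = ⟨1, 0⟩ ∨ z = ⟨-1, 0⟩ ∨ (z.re ^ 2 = 1 ∧ z.im ^ 2 = 1 ∧ z.re = z.im) ∨
      (z.re = 0 ∧ z.im ^ 2 = 1) := by
  obtain ⟨p, q⟩ := z
  simp only [nm] at h
  have hp : p ^ 2 ≤ 1 := by nlinarith [sq_nonneg (p - 2 * q)]
  have hq : q ^ 2 ≤ 1 := by nlinarith [sq_nonneg (q - 2 * p)]
  have hp1 : p ≤ 1 := by nlinarith
  have hp2 : -1 ≤ p := by nlinarith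
  have hq1 : q ≤ 1 := by nlinarith
  have hq2 : -1 ≤ q := by nlinarith
  interval_cases p <;> interval_cases q <;> simp_all

/-- Primitive Eisenstein integers `P + Q ω` with `3 ∣ Q` and cube norm are cubes. -/
theorem cube_of_norm_cube {P Q s : ℤ} (hPQ : IsCoprime P Q) (h3 : (3 : ℤ) ∣ Q)
    (hN : P ^ 2 - P * Q + Q ^ 2 = s ^ 3) :
    ∃ m n : ℤ, P = m ^ 3 + n ^ 3 - 3 * m * n ^ 2 ∧ Q = 3 * m ^ 2 * n - 3 * m * n ^ 2 ∧
      s = m ^ 2 - m * n + n ^ 2 := by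
  have hP3 : ¬ (3 : ℤ) ∣ P := by
    intro h
    have := hPQ.isUnit_of_dvd' h h3
    rw [Int.isUnit_iff] at this; omega
  have hs3 : IsCoprime (3 : ℤ) (s ^ 3) := by
    rw [Int.prime_three.coprime_iff_not_dvd]
    rw [← hN]
    intro h
    apply hP3
    have : (3 : ℤ) ∣ P ^ 2 := by
      have e : P ^ 2 = (P ^ 2 - P * Q + Q ^ 2) + Q * (P - Q) := by ring
      rw [e]; exact dvd_add h (dvd_mul_of_dvd_left h3 _)
    exact Int.prime_three.dvd_of_dvd_pow this
  set g : Eis := ⟨P, Q⟩ with hg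
  have hgg : g * cj g = (⟨s, 0⟩ : Eis) ^ 3 := by
    rw [mul_cj, cube_eq]
    ext
    · simp [nm, hg, hN]
    · simp
  have hcop : IsCoprime g (cj g) := by
    obtain ⟨u, v, huv⟩ := hPQ
    obtain ⟨k, l, hkl⟩ := hs3
    -- t = 1+2ω, t * P, t * Q in the ideal
    let w : Eis := ⟨0, 1⟩
    let w2 : Eis := ⟨-1, -1⟩
    let t : Eis := ⟨1, 2⟩
    -- w * cj g - w2 * g = t * P,   g - cj g = t * Q
    -- 3 = - t * t
    refine ⟨(⟨k, 0⟩ : Eis) * (-t) * (⟨u, 0⟩ * (-w2) + ⟨v, 0⟩) + ⟨l, 0⟩ * cj g,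
      (⟨k, 0⟩ : Eis) * (-t) * (⟨u, 0⟩ * w - ⟨v, 0⟩), ?_⟩
    have e1 : w * cj g - w2 * g = t * ⟨P, 0⟩ := by
      ext
      · simp [w, w2, t, cj, hg]
      · simp [w, w2, t, cj, hg]; ring
    have e2 : g - cj g = t * ⟨Q, 0⟩ := by
      ext
      · simp [t, cj, hg]
      · simp [t, cj, hg]; ring
    have e3 : (⟨u, 0⟩ : Eis) * ⟨P, 0⟩ + ⟨v, 0⟩ * ⟨Q, 0⟩ = 1 := by
      ext
      · simpa [QuadraticAlgebra.re_one] using huv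
      · simp [QuadraticAlgebra.im_one]
    have e4 : (⟨k, 0⟩ : Eis) * (-(t * t)) + ⟨l, 0⟩ * (⟨s, 0⟩ : Eis) ^ 3 = 1 := by
      rw [cube_eq]
      ext
      · simp [t, QuadraticAlgebra.re_one]; linarith
      · simp [t, QuadraticAlgebra.im_one]
    linear_combination (⟨k, 0⟩ : Eis) * (-t) * (⟨u, 0⟩ * e1 + ⟨v, 0⟩ * e2)
      + (⟨k, 0⟩ : Eis) * (-t * t) * e3 + e4 + (⟨l, 0⟩ : Eis) * hgg
  obtain ⟨d, hd⟩ := exists_associated_pow_of_mul_eq_pow' hcop hgg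
  obtain ⟨ε, hε⟩ := hd
  obtain ⟨m, n⟩ := d
  have hnε : nm (ε : Eis) = 1 := by
    have h1 : nm (ε : Eis) * nm ((ε⁻¹ : Eisˣ) : Eis) = 1 := by
      rw [← nm_mul, Units.mul_inv]; simp [nm, QuadraticAlgebra.re_one, QuadraticAlgebra.im_one]
    exact Int.eq_one_of_mul_eq_one_right (nm_nonneg _) h1
  have key : ∀ m n : ℤ, g = (⟨m, n⟩ : Eis) ^ 3 → ∃ m n : ℤ, P = m ^ 3 + n ^ 3 - 3 * m * n ^ 2 ∧
      Q = 3 * m ^ 2 * n - 3 * m * n ^ 2 ∧ s = m ^ 2 - m * n + n ^ 2 := by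
    intro m n h
    rw [cube_eq] at h
    have a1 : P = m ^ 3 + n ^ 3 - 3 * m * n ^ 2 := congrArg QuadraticAlgebra.re h
    have a2 : Q = 3 * m ^ 2 * n - 3 * m * n ^ 2 := congrArg QuadraticAlgebra.im h
    refine ⟨m, n, a1, a2, ?_⟩
    have : s ^ 3 = (m ^ 2 - m * n + n ^ 2) ^ 3 := by rw [← hN, a1, a2]; ring
    exact (Odd.strictMono_pow (by decide : Odd 3)).injective this
  have hre := congrArg QuadraticAlgebra.re hε
  have him := congrArg QuadraticAlgebra.im hε
  rw [cube_eq] at hre him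
  simp only [hg, QuadraticAlgebra.re_mul, QuadraticAlgebra.im_mul] at hre him
  have hbad : (ε : Eis).im ^ 2 = 1 → False := by
    intro h
    apply hP3
    obtain ⟨c, hc⟩ := h3
    generalize (ε : Eis).im = y at *
    generalize (ε : Eis).re = x at *
    have hC : m ^ 3 + n ^ 3 - 3 * m * n ^ 2 = 3 * (y * (c - (m ^ 2 * n - m * n ^ 2) * (x - y))) := by
      linear_combination (-(m ^ 3 + n ^ 3 - 3 * m * n ^ 2)) * h + y * him + y * hc
    rw [← hre, hC]
    exact ⟨y * (c - (m ^ 2 * n - m * n ^ 2) * (x - y)) * x - (m ^ 2 * n - m * n ^ 2) * y, by ring⟩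
  rcases unit_cases _ hnε with h | h | ⟨h1, h2, h3'⟩ | ⟨h1, h2⟩
  · apply key m n
    rw [← hε, h]; ext <;> simp
  · apply key (-m) (-n)
    rw [← hε, h, cube_eq, cube_eq]; ext <;> simp <;> ring
  · exact (hbad h2).elim
  · exact (hbad h2).elim
end Eis

theorem coprime_of_primes {x y : ℤ} (h : ∀ p : ℤ, Prime p → p ∣ x → p ∣ y → False) :
    IsCoprime x y := by
  apply isCoprime_of_prime_dvd
  · rintro ⟨rfl, rfl⟩
    exact h 2 Int.prime_two (dvd_zero _) (dvd_zero _)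
  · intro p hp h1 h2
    exact h p hp h1 h2

theorem not_prime_dvd_both {x y p : ℤ} (h : IsCoprime x y) (hp : Prime p) (h1 : p ∣ x)
    (h2 : p ∣ y) : False := hp.not_isUnit (h.isUnit_of_dvd' h1 h2)

theorem cube_inj {x y : ℤ} (h : x ^ 3 = y ^ 3) : x = y :=
  (Odd.strictMono_pow (by decide : Odd 3)).injective h

theorem three_dvd_cube_sub (b : ℤ) : (3 : ℤ) ∣ b ^ 3 - b := by
  have : b % 3 = 0 ∨ b % 3 = 1 ∨ b % 3 = 2 := by omega
  apply Int.dvd_of_emod_eq_zero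
  rcases this with h | h | h <;> simp [pow_succ, Int.sub_emod, Int.mul_emod, h]

theorem dvd_three_of {p : ℤ} (hp : Prime p) (h : p ∣ 3) : (3 : ℤ) ∣ p :=
  ((hp.associated_of_dvd Int.prime_three h).symm).dvd

/-- From a solution of the twisted cubic back to the Hesse cubic. -/
theorem newpt {d m n : ℤ}
    (h : d ^ 3 + (2 * m ^ 3 + 2 * n ^ 3 - 3 * m ^ 2 * n - 3 * m * n ^ 2) =
      -24 * d * (m ^ 2 - m * n + n ^ 2)) :
    ∃ x y z : ℤ, x ^ 3 + y ^ 3 + z ^ 3 = 2 * (x * y * z) ∧ x + y + z = d := by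
  have h3 : (3 : ℤ) ∣ d - m - n := by
    obtain ⟨i, hi⟩ := three_dvd_cube_sub d
    obtain ⟨j, hj⟩ := three_dvd_cube_sub m
    obtain ⟨k, hk⟩ := three_dvd_cube_sub n
    refine ⟨-8 * d * (m ^ 2 - m * n + n ^ 2) + m ^ 2 * n + m * n ^ 2 - i - m ^ 3 - n ^ 3 + j + k, ?_⟩
    linear_combination h - hi + hj + hk
  obtain ⟨z, hz⟩ := h3
  refine ⟨z + m, z + n, z, ?_, by linarith⟩
  have hd : d = 3 * z + m + n := by linarith
  subst hd
  have : (27 : ℤ) * ((z + m) ^ 3 + (z + n) ^ 3 + z ^ 3 - 2 * ((z + m) * (z + n) * z)) = 0 := by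
    linear_combination h
  linarith

theorem bc_absurd {b c p : ℤ} (hbc : IsCoprime b c) (hp : Prime p) (hp3 : ¬ p ∣ 3)
    (h1 : p ∣ b + c) (h2 : p ∣ b ^ 2 - b * c + c ^ 2) : False := by
  have h : p ∣ 3 * (b * c) := by
    have e : 3 * (b * c) = (b + c) * (b + c) - (b ^ 2 - b * c + c ^ 2) := by ring
    rw [e]; exact dvd_sub (dvd_mul_of_dvd_left h1 _) h2
  rcases hp.dvd_or_dvd h with h | h
  · exact hp3 h
  · rcases hp.dvd_or_dvd h with h | h
    · exact not_prime_dvd_both hbc hp h ((dvd_add_right h).1 h1)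
    · exact not_prime_dvd_both hbc hp ((dvd_add_left h).1 h1) h

/-- Descent along the second 3-isogeny. -/
theorem descent_two {a b c : ℤ} (hbc : IsCoprime b c)
    (h : 19 * a ^ 3 + b ^ 3 + c ^ 3 = 8 * (a * b * c)) :
    ∃ x y z : ℤ, x ^ 3 + y ^ 3 + z ^ 3 = 2 * (x * y * z) ∧ (x + y + z) ∣ a := by
  by_cases h3 : (3 : ℤ) ∣ a
  · obtain ⟨a, rfl⟩ := h3
    -- 3 ∣ b + c
    have hs : (3 : ℤ) ∣ b + c := by
      obtain ⟨i, hi⟩ := three_dvd_cube_sub b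
      obtain ⟨j, hj⟩ := three_dvd_cube_sub c
      exact ⟨8 * (a * b * c) - 19 * 9 * a ^ 3 - i - j, by linear_combination h - hi - hj⟩
    have hb3 : ¬ (3 : ℤ) ∣ b := fun hb =>
      not_prime_dvd_both hbc Int.prime_three hb ((dvd_add_right hb).1 hs)
    have hc3 : ¬ (3 : ℤ) ∣ c := fun hc =>
      not_prime_dvd_both hbc Int.prime_three ((dvd_add_left hc).1 hs) hc
    obtain ⟨e, he⟩ := hs
    have ha3 : (3 : ℤ) ∣ a := by
      have h1 : (3 : ℤ) ∣ a * b * c := by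
        have h8 : (3 : ℤ) ∣ 8 * (a * b * c) := by
          refine ⟨3 * (19 * a ^ 3) + e * (3 * e ^ 2 - b * c), ?_⟩
          have hc : c = 3 * e - b := by linarith
          subst hc
          have : (3 : ℤ) * (8 * (a * b * (3 * e - b)))
              = 3 * (3 * (3 * (19 * a ^ 3) + e * (3 * e ^ 2 - b * (3 * e - b)))) := by
            linear_combination -h
          linarith
        rcases Int.prime_three.dvd_or_dvd h8 with h | h
        · omega
        · exact h
      rcases Int.prime_three.dvd_or_dvd h1 with h | h
      · rcases Int.prime_three.dvd_or_dvd h with h | h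
        · exact h
        · exact (hb3 h).elim
      · exact (hc3 h).elim
    obtain ⟨f, hf⟩ := ha3
    -- the Eisenstein integer u + v ω
    obtain ⟨u, v, hu, hv⟩ : ∃ u v : ℤ, u + v = b - 8 * a ∧ 2 * v - u = c - 8 * a := by
      refine ⟨b - 8 * a - (e - 16 * f), e - 16 * f, by ring, ?_⟩
      linear_combination -he + 16 * hf
    have hb' : b = u + v + 8 * a := by linarith
    have hc' : c = 2 * v - u + 8 * a := by linarith
    have hprod : (3 * (b + c + 8 * a)) * (u ^ 2 - u * v + v ^ 2) = (-a) ^ 3 := by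
      have : (27 : ℤ) * ((3 * (b + c + 8 * a)) * (u ^ 2 - u * v + v ^ 2) - (-a) ^ 3) = 0 := by
        rw [hb', hc'] at h ⊢
        linear_combination 27 * h
      linarith
    have hN3 : ¬ (3 : ℤ) ∣ u ^ 2 - u * v + v ^ 2 := by
      intro hh
      have h1 : (3 : ℤ) ∣ (u + v) ^ 2 := by
        have e : (u + v) ^ 2 = (u ^ 2 - u * v + v ^ 2) + 3 * (u * v) := by ring
        rw [e]; exact dvd_add hh (dvd_mul_right _ _)
      have h2 := Int.prime_three.dvd_of_dvd_pow h1
      apply hb3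
      rw [hb', hf]
      exact dvd_add h2 ⟨8 * f, by ring⟩
    have h9 : (9 : ℤ) ∣ b + c + 8 * a := by
      have hc : IsCoprime (9 : ℤ) (u ^ 2 - u * v + v ^ 2) := by
        have := (Int.prime_three.coprime_iff_not_dvd.2 hN3).pow_left (m := 2)
        norm_num at this; exact this
      apply hc.dvd_of_dvd_mul_right
      refine ⟨-f ^ 3, ?_⟩
      have : (3 : ℤ) * ((b + c + 8 * a) * (u ^ 2 - u * v + v ^ 2)) = 3 * (9 * -f ^ 3) := by
        rw [hf] at hprod ⊢; linear_combination hprod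
      linarith
    have hv3 : (3 : ℤ) ∣ v := by
      obtain ⟨k, hk⟩ := h9
      exact ⟨k - 8 * f, by linarith⟩
    have hcop1 : IsCoprime (3 * (b + c + 8 * a)) (u ^ 2 - u * v + v ^ 2) := by
      apply coprime_of_primes
      intro p hp h1 h2
      have hpn : ¬ p ∣ 3 := fun hh => hN3 ((dvd_three_of hp hh).trans h2)
      have hpa : p ∣ a := by
        have : p ∣ (-a) ^ 3 := by rw [← hprod]; exact dvd_mul_of_dvd_left h1 _
        exact (dvd_neg).1 (hp.dvd_of_dvd_pow this)
      have h1' : p ∣ b + c := by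
        have := (hp.dvd_or_dvd h1).resolve_left hpn
        exact (dvd_add_left (dvd_mul_of_dvd_right hpa 8)).1 this
      apply bc_absurd hbc hp hpn h1'
      have e : b ^ 2 - b * c + c ^ 2 = 3 * (u ^ 2 - u * v + v ^ 2) + a * (8 * b + 8 * c - 64 * a) := by
        rw [hb', hc']; ring
      rw [e]
      exact dvd_add (dvd_mul_of_dvd_right h2 _) (dvd_mul_of_dvd_left hpa _)
    have hcop2 : IsCoprime u v := by
      apply coprime_of_primes
      intro p hp h1 h2
      have hpa : p ∣ a := by
        have : p ∣ (-a) ^ 3 := by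
          rw [← hprod]
          apply dvd_mul_of_dvd_right
          have e : u ^ 2 - u * v + v ^ 2 = u * (u - v) + v * v := by ring
          rw [e]
          exact dvd_add (dvd_mul_of_dvd_left h1 _) (dvd_mul_of_dvd_left h2 _)
        exact (dvd_neg).1 (hp.dvd_of_dvd_pow this)
      apply not_prime_dvd_both hbc hp
      · rw [hb']; exact dvd_add (dvd_add h1 h2) (dvd_mul_of_dvd_right hpa 8)
      · rw [hc']
        exact dvd_add (dvd_sub (dvd_mul_of_dvd_right h2 2) h1) (dvd_mul_of_dvd_right hpa 8)
    obtain ⟨⟨d, hd⟩, ⟨s, hs⟩⟩ := Int.eq_pow_of_mul_eq_pow_odd hcop1 (by decide) hprod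
    obtain ⟨m, n, hm, hn, hsmn⟩ := Eis.cube_of_norm_cube hcop2 hv3 hs
    have hds : d * s = -a := by
      apply cube_inj; rw [mul_pow, ← hd, ← hs, hprod]
    obtain ⟨x, y, z, hxyz, hsum⟩ := newpt (d := d) (m := -(m + n)) (n := m - 2 * n) (by
      rw [← hd, hb', hc']
      rw [hsmn] at hds
      rw [hm, hn]
      linear_combination 72 * hds)
    refine ⟨x, y, z, hxyz, ?_⟩
    rw [hsum]
    exact ⟨-3 * s, by linear_combination 3 * hds⟩
  · have hprod : (3 * b + 3 * c + 8 * a) * ((8 * a - 3 * c) ^ 2 - (8 * a - 3 * c) * (3 * (b - c))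
        + (3 * (b - c)) ^ 2) = (-a) ^ 3 := by
      linear_combination 27 * h
    have hcop1 : IsCoprime (3 * b + 3 * c + 8 * a)
        ((8 * a - 3 * c) ^ 2 - (8 * a - 3 * c) * (3 * (b - c)) + (3 * (b - c)) ^ 2) := by
      apply coprime_of_primes
      intro p hp h1 h2
      have hpa : p ∣ a := by
        have : p ∣ (-a) ^ 3 := by rw [← hprod]; exact dvd_mul_of_dvd_left h1 _
        exact (dvd_neg).1 (hp.dvd_of_dvd_pow this)
      have hpn : ¬ p ∣ 3 := fun hh => h3 ((dvd_three_of hp hh).trans hpa)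
      have h1' : p ∣ b + c := by
        have : p ∣ 3 * (b + c) := by
          have := (dvd_add_left (dvd_mul_of_dvd_right hpa 8)).1 h1
          rwa [← mul_add] at this
        exact (hp.dvd_or_dvd this).resolve_left hpn
      apply bc_absurd hbc hp hpn h1'
      have : p ∣ 3 * (3 * (b ^ 2 - b * c + c ^ 2)) := by
        have e : 3 * (3 * (b ^ 2 - b * c + c ^ 2)) =
          ((8 * a - 3 * c) ^ 2 - (8 * a - 3 * c) * (3 * (b - c)) + (3 * (b - c)) ^ 2)
            - a * (64 * a - 24 * b - 24 * c) := by ring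
        rw [e]; exact dvd_sub h2 (dvd_mul_of_dvd_left hpa _)
      exact (hp.dvd_or_dvd ((hp.dvd_or_dvd this).resolve_left hpn)).resolve_left hpn
    have hcop2 : IsCoprime (8 * a - 3 * c) (3 * (b - c)) := by
      apply coprime_of_primes
      intro p hp h1 h2
      have hpa : p ∣ a := by
        have : p ∣ (-a) ^ 3 := by
          rw [← hprod]
          apply dvd_mul_of_dvd_right
          have e : (8 * a - 3 * c) ^ 2 - (8 * a - 3 * c) * (3 * (b - c)) + (3 * (b - c)) ^ 2 =
            (8 * a - 3 * c) * ((8 * a - 3 * c) - (3 * (b - c))) + (3 * (b - c)) * (3 * (b - c)) := by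
            ring
          rw [e]
          exact dvd_add (dvd_mul_of_dvd_left h1 _) (dvd_mul_of_dvd_left h2 _)
        exact (dvd_neg).1 (hp.dvd_of_dvd_pow this)
      have hpn : ¬ p ∣ 3 := fun hh => h3 ((dvd_three_of hp hh).trans hpa)
      have hc : p ∣ c :=
        (hp.dvd_or_dvd ((dvd_sub_right (dvd_mul_of_dvd_right hpa 8)).1 h1)).resolve_left hpn
      have hb : p ∣ b - c := (hp.dvd_or_dvd h2).resolve_left hpn
      exact not_prime_dvd_both hbc hp ((dvd_sub_left hc).1 hb) hc
    obtain ⟨⟨d, hd⟩, ⟨s, hs⟩⟩ := Int.eq_pow_of_mul_eq_pow_odd hcop1 (by decide) hprod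
    obtain ⟨m, n, hm, hn, hsmn⟩ := Eis.cube_of_norm_cube hcop2 (dvd_mul_right _ _) hs
    have hds : d * s = -a := by
      apply cube_inj; rw [mul_pow, ← hd, ← hs, hprod]
    obtain ⟨x, y, z, hxyz, hsum⟩ := newpt (d := d) (m := m) (n := n) (by
      rw [← hd]
      rw [hsmn] at hds
      linear_combination 24 * hds - 2 * hm + hn)
    refine ⟨x, y, z, hxyz, ?_⟩
    rw [hsum]
    exact ⟨-s, by linear_combination hds⟩

theorem coprime_pair {x y z : ℤ} (h : x ^ 3 + y ^ 3 + z ^ 3 = 2 * (x * y * z))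
    (hg : ∀ p : ℤ, Prime p → p ∣ x → p ∣ y → p ∣ z → False) :
    ∀ p : ℤ, Prime p → p ∣ x → p ∣ y → False := by
  intro p hp h1 h2
  apply hg p hp h1 h2
  apply hp.dvd_of_dvd_pow (n := 3)
  have e : z ^ 3 = x * (2 * y * z - x ^ 2) - y * y ^ 2 := by linear_combination h
  rw [e]
  exact dvd_sub (dvd_mul_of_dvd_left h1 _) (dvd_mul_of_dvd_left h2 _)

theorem prime_nineteen : Prime (19 : ℤ) := by
  rw [Int.prime_iff_natAbs_prime]; norm_num

theorem L_prod {x y z : ℤ} (h : x ^ 3 + y ^ 3 + z ^ 3 = 2 * (x * y * z)) :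
    (2 * x + 3 * y + 3 * z) * (3 * x + 2 * y + 3 * z) * (3 * x + 3 * y + 2 * z) =
      19 * (x + y + z) ^ 3 := by
  linear_combination (-1) * h

theorem L_coprime {x y z : ℤ} (h : x ^ 3 + y ^ 3 + z ^ 3 = 2 * (x * y * z))
    (hg : ∀ p : ℤ, Prime p → p ∣ x → p ∣ y → False) :
    IsCoprime (2 * x + 3 * y + 3 * z) (3 * x + 2 * y + 3 * z) := by
  apply coprime_of_primes
  intro p hp h1 h2
  have hA : p ∣ x + y + z := by
    have hL := L_prod h
    obtain ⟨i, hi⟩ := h1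
    obtain ⟨j, hj⟩ := h2
    rw [hi, hj] at hL
    have h19 : p ∣ 19 * (x + y + z) ^ 3 := ⟨i * (p * j) * (3 * x + 3 * y + 2 * z), by
      linear_combination -hL⟩
    rcases hp.dvd_or_dvd h19 with h | h
    · have hass := (hp.associated_of_dvd prime_nineteen h)
      have h19p : (19 : ℤ) ∣ p := hass.symm.dvd
      obtain ⟨k, hk⟩ := h19p
      apply hp.dvd_of_dvd_pow (n := 3)
      refine ⟨k * i * j * (3 * x + 3 * y + 2 * z), ?_⟩
      have : (19 : ℤ) * (x + y + z) ^ 3 = 19 * (p * (k * i * j * (3 * x + 3 * y + 2 * z))) := by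
        rw [← hL]; linear_combination (i * p * j * (3 * x + 3 * y + 2 * z)) * hk
      linarith
    · exact hp.dvd_of_dvd_pow h
  apply hg p hp
  · have e : x = 3 * (x + y + z) - (2 * x + 3 * y + 3 * z) := by ring
    rw [e]; exact dvd_sub (dvd_mul_of_dvd_right hA 3) h1
  · have e : y = 3 * (x + y + z) - (3 * x + 2 * y + 3 * z) := by ring
    rw [e]; exact dvd_sub (dvd_mul_of_dvd_right hA 3) h2

/-- One full descent step, with the factor 19 sitting on the first tangent line. -/
theorem step {x y z : ℤ} (h : x ^ 3 + y ^ 3 + z ^ 3 = 2 * (x * y * z))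
    (hg : ∀ p : ℤ, Prime p → p ∣ x → p ∣ y → p ∣ z → False)
    (hA : x + y + z ≠ 0) (h19 : (19 : ℤ) ∣ 2 * x + 3 * y + 3 * z) :
    ∃ x' y' z' : ℤ, x' ^ 3 + y' ^ 3 + z' ^ 3 = 2 * (x' * y' * z') ∧ x' + y' + z' ≠ 0 ∧
      (x' + y' + z').natAbs < (x + y + z).natAbs := by
  have c12 := L_coprime h (coprime_pair h hg)
  have h' : y ^ 3 + z ^ 3 + x ^ 3 = 2 * (y * z * x) := by linear_combination h
  have c23 := L_coprime h' (coprime_pair h' (fun p hp a b c => hg p hp c a b))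
  have h'' : x ^ 3 + z ^ 3 + y ^ 3 = 2 * (x * z * y) := by linear_combination h
  have c13 := L_coprime h'' (coprime_pair h'' (fun p hp a b c => hg p hp a c b))
  have hL := L_prod h
  have e1 : 2 * x + 3 * z + 3 * y = 2 * x + 3 * y + 3 * z := by ring
  have e2 : 3 * x + 2 * z + 3 * y = 3 * x + 3 * y + 2 * z := by ring
  have e3 : 2 * y + 3 * z + 3 * x = 3 * x + 2 * y + 3 * z := by ring
  have e4 : 3 * y + 2 * z + 3 * x = 3 * x + 3 * y + 2 * z := by ring
  rw [e1, e2] at c13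
  rw [e3, e4] at c23
  have hsum : (2 * x + 3 * y + 3 * z) + (3 * x + 2 * y + 3 * z) + (3 * x + 3 * y + 2 * z)
    = 8 * (x + y + z) := by ring
  generalize 2 * x + 3 * y + 3 * z = L1 at *
  generalize 3 * x + 2 * y + 3 * z = L2 at *
  generalize 3 * x + 3 * y + 2 * z = L3 at *
  generalize x + y + z = A at *
  obtain ⟨M, rfl⟩ := h19
  have d12 : IsCoprime M L2 := c12.of_mul_left_right
  have d13 : IsCoprime M L3 := c13.of_mul_left_right
  have hML : M * (L2 * L3) = A ^ 3 := by linarith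
  obtain ⟨⟨a, ha⟩, ⟨t, ht⟩⟩ := Int.eq_pow_of_mul_eq_pow_odd (d12.mul_right d13) (by decide) hML
  obtain ⟨⟨b, hb⟩, ⟨c, hc⟩⟩ := Int.eq_pow_of_mul_eq_pow_odd c23 (by decide) ht
  have habc : A = a * b * c := by
    apply cube_inj; rw [← hML, ha, hb, hc]; ring
  subst ha hb hc habc
  have hbc : IsCoprime b c := by
    rwa [IsCoprime.pow_iff (by norm_num) (by norm_num)] at c23
  obtain ⟨x', y', z', hx, hdvd⟩ := descent_two hbc hsum
  have ha0 : a ≠ 0 := by rintro rfl; simp at hA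
  have hb0 : b ≠ 0 := by rintro rfl; simp at hA
  have hc0 : c ≠ 0 := by rintro rfl; simp at hA
  refine ⟨x', y', z', hx, ?_, ?_⟩
  · intro h0; rw [h0, zero_dvd_iff] at hdvd; exact ha0 hdvd
  · have h1 : (x' + y' + z').natAbs ≤ a.natAbs :=
      Nat.le_of_dvd (Int.natAbs_pos.2 ha0) (Int.natAbs_dvd_natAbs.2 hdvd)
    apply lt_of_le_of_lt h1
    rw [Int.natAbs_mul, Int.natAbs_mul, mul_assoc]
    have pa := Int.natAbs_pos.2 ha0
    have pb := Int.natAbs_pos.2 hb0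
    have pc := Int.natAbs_pos.2 hc0
    by_contra hlt
    have hle : b.natAbs * c.natAbs ≤ 1 := by
      by_contra h2
      apply hlt
      nlinarith
    have hb1 : b.natAbs = 1 := by nlinarith
    have hc1 : c.natAbs = 1 := by nlinarith
    have key : ∀ a : ℤ, a ≠ 0 → 19 * a ^ 3 - 8 * a + 2 ≠ 0 ∧ 19 * a ^ 3 - 8 * a - 2 ≠ 0 ∧
        19 * a ^ 3 + 8 * a ≠ 0 := by
      intro a ha
      rcases lt_or_gt_of_ne ha with h | h
      · have h1 : a ≤ -1 := by omega
        have h2 : 1 ≤ a ^ 2 := by nlinarith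
        refine ⟨?_, ?_, ?_⟩ <;> intro hh <;> nlinarith
      · have h1 : 1 ≤ a := by omega
        have h2 : 1 ≤ a ^ 2 := by nlinarith
        refine ⟨?_, ?_, ?_⟩ <;> intro hh <;> nlinarith
    obtain ⟨k1, k2, k3⟩ := key a ha0
    rcases Int.natAbs_eq_iff.1 hb1 with rfl | rfl <;>
      rcases Int.natAbs_eq_iff.1 hc1 with rfl | rfl <;> norm_num at hsum
    · exact k1 (by linarith)
    · exact k3 (by linarith)
    · exact k3 (by linarith)
    · exact k2 (by linarith)

/-- The Hesse cubic `x³ + y³ + z³ = 2xyz` has only the trivial solutions over `ℤ`. -/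
theorem hesse_int : ∀ (N : ℕ) (x y z : ℤ), (x + y + z).natAbs = N →
    x ^ 3 + y ^ 3 + z ^ 3 = 2 * (x * y * z) → x + y + z = 0 := by
  intro N
  induction N using Nat.strong_induction_on with
  | _ N ih =>
    intro x y z hN h
    by_contra hA
    by_cases hg : ∀ p : ℤ, Prime p → p ∣ x → p ∣ y → p ∣ z → False
    · have fin : ∀ x' y' z' : ℤ, x' ^ 3 + y' ^ 3 + z' ^ 3 = 2 * (x' * y' * z') →
          x' + y' + z' ≠ 0 → (x' + y' + z').natAbs < (x + y + z).natAbs → False := by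
        intro x' y' z' e1 e2 e3
        exact e2 (ih _ (hN ▸ e3) x' y' z' rfl e1)
      have h19 : (19 : ℤ) ∣ (2 * x + 3 * y + 3 * z) * (3 * x + 2 * y + 3 * z) *
          (3 * x + 3 * y + 2 * z) := by
        rw [L_prod h]; exact dvd_mul_right _ _
      rcases prime_nineteen.dvd_or_dvd h19 with h1 | h1
      · rcases prime_nineteen.dvd_or_dvd h1 with h1 | h1
        · obtain ⟨x', y', z', e1, e2, e3⟩ := step h hg hA h1
          exact fin x' y' z' e1 e2 e3
        · obtain ⟨x', y', z', e1, e2, e3⟩ := step (x := y) (y := z) (z := x)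
            (by linear_combination h) (fun p hp a b c => hg p hp c a b)
            (by intro h0; exact hA (by linarith))
            (by rw [show 2 * y + 3 * z + 3 * x = 3 * x + 2 * y + 3 * z by ring]; exact h1)
          exact fin x' y' z' e1 e2 (by
            have e : ∀ p q r : ℤ, p = q → r.natAbs < p.natAbs → r.natAbs < q.natAbs := by
              rintro p q r rfl h; exact h
            exact e _ _ _ (by ring) e3)
      · obtain ⟨x', y', z', e1, e2, e3⟩ := step (x := z) (y := x) (z := y)
            (by linear_combination h) (fun p hp a b c => hg p hp b c a)
            (by intro h0; exact hA (by linarith))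
            (by rw [show 2 * z + 3 * x + 3 * y = 3 * x + 3 * y + 2 * z by ring]; exact h1)
        exact fin x' y' z' e1 e2 (by
            have e : ∀ p q r : ℤ, p = q → r.natAbs < p.natAbs → r.natAbs < q.natAbs := by
              rintro p q r rfl h; exact h
            exact e _ _ _ (by ring) e3)
    · push Not at hg
      obtain ⟨p, hp, ⟨x', rfl⟩, ⟨y', rfl⟩, ⟨z', rfl⟩, -⟩ := hg
      have hsum : p * x' + p * y' + p * z' = p * (x' + y' + z') := by ring
      rw [hsum] at hA hN
      have hA' : x' + y' + z' ≠ 0 := right_ne_zero_of_mul hA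
      apply hA'
      refine ih (x' + y' + z').natAbs ?_ x' y' z' rfl ?_
      · rw [← hN, Int.natAbs_mul]
        have h2 : 2 ≤ p.natAbs := (Int.prime_iff_natAbs_prime.1 hp).two_le
        have := Int.natAbs_pos.2 hA'
        nlinarith
      · have hp3 : p ^ 3 ≠ 0 := pow_ne_zero _ hp.ne_zero
        apply mul_left_cancel₀ hp3
        linear_combination h

theorem hesse_rat (x y z : ℚ) (h : x ^ 3 + y ^ 3 + z ^ 3 = 2 * (x * y * z)) :
    x + y + z = 0 := by
  have hx : (x.den : ℚ) ≠ 0 := by exact_mod_cast x.den_nz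
  have hy : (y.den : ℚ) ≠ 0 := by exact_mod_cast y.den_nz
  have hz : (z.den : ℚ) ≠ 0 := by exact_mod_cast z.den_nz
  have ex : (x.den : ℚ) * x = x.num := by rw [mul_comm]; exact Rat.mul_den_eq_num x
  have ey : (y.den : ℚ) * y = y.num := by rw [mul_comm]; exact Rat.mul_den_eq_num y
  have ez : (z.den : ℚ) * z = z.num := by rw [mul_comm]; exact Rat.mul_den_eq_num z
  have key := hesse_int _ (x.num * y.den * z.den) (x.den * y.num * z.den) (x.den * y.den * z.num)
    rfl (by
      have : ((x.num * y.den * z.den : ℚ)) ^ 3 + ((x.den * y.num * z.den : ℚ)) ^ 3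
        + ((x.den * y.den * z.num : ℚ)) ^ 3 = 2 * ((x.num * y.den * z.den : ℚ)
          * (x.den * y.num * z.den) * (x.den * y.den * z.num)) := by
        rw [← ex, ← ey, ← ez]
        linear_combination ((x.den : ℚ) * y.den * z.den) ^ 3 * h
      exact_mod_cast this)
  have key' : ((x.num * y.den * z.den : ℚ)) + ((x.den * y.num * z.den : ℚ))
        + ((x.den * y.den * z.num : ℚ)) = 0 := by exact_mod_cast key
  rw [← ex, ← ey, ← ez] at key'
  have : ((x.den : ℚ) * y.den * z.den) * (x + y + z) = 0 := by linear_combination key'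
  exact (mul_eq_zero.1 this).resolve_left (by positivity)

theorem curve_points (a u : ℚ)
    (h : u ^ 2 = -3 * a ^ 4 - 16 * a ^ 3 - 50 * a ^ 2 - 60 * a - 23) :
    (a = -1 ∧ u = 0) ∨ (a = -6 / 7 ∧ (u = 19 / 49 ∨ u = -19 / 49)) := by
  by_cases hs : a + 1 = 0
  · left
    have ha : a = -1 := by linarith
    subst ha
    refine ⟨rfl, ?_⟩
    norm_num at h
    exact h
  · right
    have hD : ∃ D : ℚ, u = D * (a + 1) := ⟨u / (a + 1), by field_simp⟩
    obtain ⟨D, rfl⟩ := hD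
    have hD2 : D ^ 2 * (a + 1) =
        -3 * (a + 1) ^ 3 - 4 * (a + 1) ^ 2 - 20 * (a + 1) + 4 := by
      apply mul_left_cancel₀ hs
      linear_combination h
    have := hesse_rat ((5 * (a + 1) + 2 + D) / 2) ((5 * (a + 1) + 2 - D) / 2) (2 * (a + 1) - 3)
      (by linear_combination (19 / 4) * hD2)
    have ha : a = -6 / 7 := by linarith
    refine ⟨ha, ?_⟩
    subst ha
    norm_num at hD2 ⊢
    have : (D - 19 / 7) * (D + 19 / 7) = 0 := by linarith
    rcases mul_eq_zero.1 this with h | h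
    · left; linarith
    · right; linarith

/-- The rational points on `u² = -3a⁴ - 16a³ - 50a² - 60a - 23` are exactly
`(-1, 0)`, `(-6/7, 19/49)`, `(-6/7, -19/49)`; consequently the only
`a ∈ ℚ \ {0, -1, -2}` for which the discriminant of the first dynatomic
polynomial of `φ_a` is a square in `ℚ` is `a = -6/7`. -/
theorem stmt_3 :
    ({p : ℚ × ℚ |
        p.2 ^ 2 = -3 * p.1 ^ 4 - 16 * p.1 ^ 3 - 50 * p.1 ^ 2 - 60 * p.1 - 23} =
      ({(-1, 0), (-6/7, 19/49), (-6/7, -19/49)} : Set (ℚ × ℚ))) ∧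
    ∀ a : ℚ, a ≠ 0 → a ≠ -1 → a ≠ -2 →
      (IsSquare (-3 * a ^ 4 - 16 * a ^ 3 - 50 * a ^ 2 - 60 * a - 23) ↔
        a = -6/7) := by
  constructor
  · ext ⟨a, u⟩
    simp only [Set.mem_ofPred_eq, Set.mem_insert_iff, Set.mem_singleton_iff, Prod.mk.injEq]
    constructor
    · intro h
      rcases curve_points a u h with h | ⟨h1, h2 | h2⟩
      · exact Or.inl h
      · exact Or.inr (Or.inl ⟨h1, h2⟩)
      · exact Or.inr (Or.inr ⟨h1, h2⟩)
    · rintro (⟨rfl, rfl⟩ | ⟨rfl, rfl⟩ | ⟨rfl, rfl⟩) <;> norm_num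
  · intro a _ h1 _
    constructor
    · rintro ⟨u, hu⟩
      rcases curve_points a u (by rw [hu]; ring) with h | h
      · exact (h1 h.1).elim
      · exact h.1
    · rintro rfl
      exact ⟨19 / 49, by norm_num⟩
end

section
/- The only pairs (a, t) ∈ ℚ × ℚ satisfying a²t² − a²t + 2at² + t² − a = 0 are (a, t) = (0, 0) and (a, t) = (−1, 1). -/
namespace N3E2
open Polynomial NumberField
open scoped Matrix

noncomputable abbrev g : ℚ[X] := X ^ 3 - 2 * X ^ 2 + 2

lemma g_monic : g.Monic := by unfold g; monicity!
lemma g_deg : g.natDegree = 3 := by unfold g; compute_degree!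

lemma g_irr : Irreducible g := by
  rw [Polynomial.irreducible_iff_roots_eq_zero_of_degree_le_three (by rw [g_deg]; norm_num) (by rw [g_deg])]
  rw [Multiset.eq_zero_iff_forall_notMem]
  intro x hx
  have hx := (mem_roots'.1 hx).2
  simp only [g, IsRoot.def, eval_add, eval_sub, eval_mul, eval_pow, eval_X, eval_ofNat] at hx
  have h1 : (x.num : ℚ) / x.den = x := Rat.num_div_den x
  have hd : (x.den : ℚ) ≠ 0 := by exact_mod_cast x.den_nz
  rw [← h1] at hx
  field_simp at hx
  have hz : (x.num : ℤ) ^ 3 - 2 * x.num ^ 2 * x.den + 2 * x.den ^ 3 = 0 := by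
    have : ((x.num ^ 3 - 2 * x.num ^ 2 * x.den + 2 * x.den ^ 3 : ℤ) : ℚ) = 0 := by
      push_cast; linear_combination hx
    exact_mod_cast this
  have h2 : (2 : ℤ) ∣ x.num := by
    apply Int.prime_two.dvd_of_dvd_pow (n := 3)
    exact ⟨x.num ^ 2 * x.den - x.den ^ 3, by linear_combination hz⟩
  obtain ⟨k, hk⟩ := h2
  rw [hk] at hz
  have h3 : (2 : ℤ) ∣ x.den := by
    apply Int.prime_two.dvd_of_dvd_pow (n := 3)
    exact ⟨2 * k ^ 2 * x.den - 2 * k ^ 3, by linarith⟩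
  have hc := x.reduced
  have h4 : (2 : ℕ) ∣ x.num.natAbs := by omega
  have h5 : (2 : ℕ) ∣ x.den := by omega
  have := Nat.dvd_gcd h4 h5
  rw [hc] at this
  omega

instance : Fact (Irreducible g) := ⟨g_irr⟩

abbrev K := AdjoinRoot g

noncomputable def pb : PowerBasis ℚ K := AdjoinRoot.powerBasis g_irr.ne_zero

lemma pb_dim : pb.dim = 3 := by simp [pb, g_deg]

noncomputable def b : Module.Basis (Fin 3) ℚ K := pb.basis.reindex (finCongr pb_dim)

noncomputable def th : K := AdjoinRoot.root g

lemma b_apply (i : Fin 3) : b i = th ^ (i : ℕ) := by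
  simp [b, th, pb]
  rfl

instance : NumberField K where
  to_charZero := inferInstance
  to_finiteDimensional := b.finiteDimensional_of_finite

lemma finrank_K : Module.finrank ℚ K = 3 := by
  rw [Module.finrank_eq_card_basis b]; rfl

lemma th_eq : th ^ 3 = 2 * th ^ 2 - 2 := by
  have := AdjoinRoot.eval₂_root g
  simp [g] at this
  unfold th
  linear_combination this

lemma th_int : IsIntegral ℤ th := by
  refine ⟨X ^ 3 - 2 * X ^ 2 + 2, by monicity!, ?_⟩
  simp
  linear_combination th_eq

noncomputable def θ : 𝓞 K := ⟨th, th_int⟩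

lemma θ_coe : (algebraMap (𝓞 K) K θ) = th := rfl

lemma θ_eq : θ ^ 3 = 2 * θ ^ 2 - 2 := by
  apply RingOfIntegers.ext
  have := th_eq
  simpa [θ_coe, map_ofNat] using this

lemma repr_comb (x y z : ℚ) (i : Fin 3) :
    b.repr ((x : K) + y * th + z * th ^ 2) i = ![x, y, z] i := by
  have h : (x : K) + y * th + z * th ^ 2 = ∑ j, (![x, y, z] j) • b j := by
    simp [Fin.sum_univ_three, b_apply, Algebra.smul_def]
  rw [h, Module.Basis.repr_sum_self]

lemma trace_comb (x y z : ℚ) :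
    Algebra.trace ℚ K ((x : K) + y * th + z * th ^ 2) = 3 * x + 2 * y + 4 * z := by
  rw [Algebra.trace_eq_matrix_trace b, Matrix.trace, Fin.sum_univ_three]
  simp only [Matrix.diag_apply, Algebra.leftMulMatrix_eq_repr_mul, b_apply]
  have h0 : ((x : K) + y * th + z * th ^ 2) * th ^ ((0 : Fin 3) : ℕ)
    = ((x : ℚ) : K) + (y : ℚ) * th + (z : ℚ) * th ^ 2 := by simp
  have h1 : ((x : K) + y * th + z * th ^ 2) * th ^ ((1 : Fin 3) : ℕ)
    = ((-2 * z : ℚ) : K) + (x : ℚ) * th + (y + 2 * z : ℚ) * th ^ 2 := by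
    push_cast; simp; linear_combination (z : K) * th_eq
  have h2 : ((x : K) + y * th + z * th ^ 2) * th ^ ((2 : Fin 3) : ℕ)
    = ((-2 * y - 4 * z : ℚ) : K) + (-2 * z : ℚ) * th + (x + 2 * y + 4 * z : ℚ) * th ^ 2 := by
    push_cast; simp; linear_combination (z * th + y + 2 * z : K) * th_eq
  rw [h0, h1, h2]
  have h1' := repr_comb (-2 * z) x (y + 2 * z) 1
  have h2' := repr_comb (-2 * y - 4 * z) (-2 * z) (x + 2 * y + 4 * z) 2
  push_cast at h1' h2' ⊢
  rw [repr_comb, h1', h2']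
  simp; ring

lemma discr_b : Algebra.discr ℚ b = -44 := by
  rw [Algebra.discr_def, Matrix.det_fin_three]
  simp only [Algebra.traceMatrix_apply, Algebra.traceForm_apply, b_apply]
  have t0 := trace_comb 1 0 0
  have t1 := trace_comb 0 1 0
  have t2 := trace_comb 0 0 1
  have t3 : Algebra.trace ℚ K (th ^ 3) = 2 := by
    have := trace_comb (-2) 0 2
    rw [th_eq, show (2 * th ^ 2 - 2 : K) = ((-2 : ℚ) : K) + (0 : ℚ) * th + (2 : ℚ) * th ^ 2 by
      push_cast; ring, this]; norm_num
  have t4 : Algebra.trace ℚ K (th ^ 4) = 0 := by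
    have := trace_comb (-4) (-2) 4
    rw [show (th ^ 4 : K) = ((-4 : ℚ) : K) + (-2 : ℚ) * th + (4 : ℚ) * th ^ 2 by
      push_cast; linear_combination (th + 2) * th_eq, this]; norm_num
  simp only [Rat.cast_one, Rat.cast_zero, zero_mul, one_mul, add_zero, zero_add, mul_zero, mul_one] at t0 t1 t2
  simp only [← pow_add]
  norm_num
  simp only [t0, t1, t2, t3, t4]
  norm_num [t0, t1, t2, t3, t4]

lemma index : ∃ d : ℤ, d ^ 2 * discr K = -44 ∧
    ∀ s : 𝓞 K, ∃ x y z : ℤ, (d : 𝓞 K) * s = x + y * θ + z * θ ^ 2 := by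
  have hcard : Fintype.card (Module.Free.ChooseBasisIndex ℤ (𝓞 K)) = Fintype.card (Fin 3) := by
    rw [← Module.finrank_eq_card_chooseBasisIndex, RingOfIntegers.rank, finrank_K]; rfl
  let c : Module.Basis (Fin 3) ℤ (𝓞 K) :=
    (RingOfIntegers.basis K).reindex (Fintype.equivOfCardEq hcard)
  let v : Fin 3 → 𝓞 K := fun i => θ ^ (i : ℕ)
  let P := c.toMatrix v
  have hv : c ᵥ* P.map (algebraMap ℤ (𝓞 K)) = v := c.toMatrix_map_vecMul v
  have h1 : Algebra.discr ℤ v = P.det ^ 2 * discr K := by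
    rw [← hv, Algebra.discr_of_matrix_vecMul, discr_eq_discr]
  have h2 : ((Algebra.discr ℤ v : ℤ) : ℚ) = Algebra.discr ℚ b := by
    rw [Algebra.discr_def, Algebra.discr_def, Int.cast_det]
    congr 1
    ext i j
    simp only [Matrix.map_apply, Algebra.traceMatrix_apply, Algebra.traceForm_apply, b_apply, v]
    rw [Algebra.coe_trace_int]
    simp [θ_coe]
  rw [discr_b, h1] at h2
  refine ⟨P.det, by exact_mod_cast h2, fun s => ?_⟩
  let w := P.adjugate.mulVec (c.repr s)
  have hw : P.mulVec w = fun i => P.det * c.repr s i := by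
    simp only [w, Matrix.mulVec_mulVec, Matrix.mul_adjugate, Matrix.smul_mulVec, Matrix.one_mulVec]
    rfl
  have key : (P.det : 𝓞 K) * s = ∑ j, w j • v j := by
    apply c.repr.injective
    ext i
    have := congrFun hw i
    simp only [Matrix.mulVec, dotProduct] at this
    rw [← zsmul_eq_mul, map_zsmul, map_sum]
    simp only [Finsupp.smul_apply, Finsupp.coe_finsetSum, Finset.sum_apply, map_zsmul, smul_eq_mul]
    rw [← this]
    refine Finset.sum_congr rfl fun j _ => ?_
    rw [mul_comm]; rfl
  refine ⟨w 0, w 1, w 2, ?_⟩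
  rw [key, Fin.sum_univ_three]
  simp [v]

lemma nrC : InfinitePlace.nrComplexPlaces K = 1 := by
  obtain ⟨d, hd, -⟩ := index
  have h := sign_discr K
  have h3 := InfinitePlace.card_add_two_mul_card_eq_rank K
  rw [finrank_K] at h3
  have hneg : discr K < 0 := by
    by_contra hh
    push Not at hh
    have := mul_nonneg (sq_nonneg d) hh
    omega
  rw [Int.sign_eq_neg_one_of_neg hneg] at h
  have : InfinitePlace.nrComplexPlaces K = 0 ∨ InfinitePlace.nrComplexPlaces K = 1 := by omega
  rcases this with h0 | h0
  · rw [h0] at h; norm_num at h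
  · exact h0

lemma rank_one : Units.rank K = 1 := by
  have h3 := InfinitePlace.card_add_two_mul_card_eq_rank K
  rw [finrank_K, nrC] at h3
  rw [Units.rank, InfinitePlace.card_eq_nrRealPlaces_add_nrComplexPlaces, nrC]
  omega

instance pid : IsPrincipalIdealRing (𝓞 K) := by
  obtain ⟨d, hd, -⟩ := index
  apply RingOfIntegers.isPrincipalIdealRing_of_abs_discr_lt
  rw [nrC, finrank_K]
  have hd0 : 1 ≤ d ^ 2 := by
    have : d ≠ 0 := by rintro rfl; norm_num at hd
    have := sq_pos_of_ne_zero this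
    omega
  have h1 : |discr K| ≤ 44 := by
    rw [abs_le]; constructor <;> nlinarith
  have h2 : ((|discr K| : ℤ) : ℝ) ≤ 44 := by exact_mod_cast h1
  refine lt_of_le_of_lt h2 ?_
  norm_num [Nat.factorial]
  nlinarith [Real.pi_gt_three]

lemma index_two (s : 𝓞 K) : ∃ x y z : ℤ, 2 * s = x + y * θ + z * θ ^ 2 := by
  obtain ⟨d, hd, h⟩ := index
  have hdv : d ^ 2 ∣ 44 := ⟨- discr K, by linarith⟩
  have hd0 : d ≠ 0 := by rintro rfl; norm_num at hd
  have hle : d ^ 2 ≤ 44 := Int.le_of_dvd (by norm_num) hdv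
  have h1 : d ≤ 6 := by nlinarith
  have h2 : -6 ≤ d := by nlinarith
  obtain ⟨x, y, z, hs⟩ := h s
  have : d = 1 ∨ d = -1 ∨ d = 2 ∨ d = -2 := by
    interval_cases d <;> revert hdv <;> decide
  rcases this with rfl | rfl | rfl | rfl
  · exact ⟨2 * x, 2 * y, 2 * z, by push_cast at *; linear_combination 2 * hs⟩
  · exact ⟨-2 * x, -2 * y, -2 * z, by push_cast at *; linear_combination -2 * hs⟩
  · exact ⟨x, y, z, by push_cast at *; linear_combination hs⟩
  · exact ⟨-x, -y, -z, by push_cast at *; linear_combination -hs⟩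

lemma coord_inj {x y z x' y' z' : ℤ}
    (h : (x : 𝓞 K) + y * θ + z * θ ^ 2 = x' + y' * θ + z' * θ ^ 2) : x = x' ∧ y = y' ∧ z = z' := by
  have h := congrArg (algebraMap (𝓞 K) K) h
  simp only [map_add, map_mul, map_pow, map_intCast, θ_coe] at h
  have e (i : Fin 3) : ![(x : ℚ), y, z] i = ![(x' : ℚ), y', z'] i := by
    rw [← repr_comb, ← repr_comb]; push_cast; rw [h]
  have e0 := e 0
  have e1 := e 1
  have e2 := e 2
  simp at e0 e1 e2
  exact ⟨e0, e1, e2⟩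

lemma sq_coord (x y z : ℤ) : ((x : 𝓞 K) + y * θ + z * θ ^ 2) ^ 2 =
    ((x ^ 2 - 4 * y * z - 4 * z ^ 2 : ℤ) : 𝓞 K) + ((2 * x * y - 2 * z ^ 2 : ℤ) : 𝓞 K) * θ
      + ((y ^ 2 + 2 * x * z + 4 * y * z + 4 * z ^ 2 : ℤ) : 𝓞 K) * θ ^ 2 := by
  push_cast
  linear_combination (2 * y * z + z ^ 2 * (θ + 2)) * θ_eq

/-- squares with coordinates `(p, q, r)`, integrality -/
lemma sq_int (s : 𝓞 K) (p q r : ℤ) (h : s ^ 2 = p + q * θ + r * θ ^ 2) :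
    ∃ x y z : ℤ, p = x ^ 2 - 4 * y * z - 4 * z ^ 2 ∧ q = 2 * (x * y - z ^ 2) ∧
      r = y ^ 2 + 2 * x * z + 4 * y * z + 4 * z ^ 2 := by
  obtain ⟨x, y, z, hs⟩ := index_two s
  have h1 : ((4 * p : ℤ) : 𝓞 K) + ((4 * q : ℤ) : 𝓞 K) * θ + ((4 * r : ℤ) : 𝓞 K) * θ ^ 2 =
    ((x : 𝓞 K) + y * θ + z * θ ^ 2) ^ 2 := by
    rw [← hs]; push_cast at *; linear_combination -4 * h
  rw [sq_coord] at h1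
  obtain ⟨e0, e1, e2⟩ := coord_inj h1
  have hx : Even x := by
    have : Even (x ^ 2) := ⟨2 * p + 2 * y * z + 2 * z ^ 2, by linarith⟩
    exact (Int.even_pow.1 this).1
  obtain ⟨x', rfl⟩ := hx
  have hy : Even y := by
    have : Even (y ^ 2) := ⟨2 * r - 2 * x' * z - 2 * y * z - 2 * z ^ 2, by linarith⟩
    exact (Int.even_pow.1 this).1
  obtain ⟨y', rfl⟩ := hy
  have hz : Even z := by
    have : Even (z ^ 2) := ⟨2 * x' * y' - q, by linarith⟩
    exact (Int.even_pow.1 this).1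
  obtain ⟨z', rfl⟩ := hz
  exact ⟨x', y', z', by linarith, by linarith, by linarith⟩

/-- the unit `1 - θ` -/
noncomputable def ε : (𝓞 K)ˣ where
  val := 1 - θ
  inv := θ ^ 2 - θ - 1
  val_inv := by linear_combination -θ_eq
  inv_val := by linear_combination -θ_eq

lemma ε_val : (ε : 𝓞 K) = 1 - θ := rfl

lemma ε_not_sq (t : 𝓞 K) : (ε : 𝓞 K) ≠ t ^ 2 := by
  intro h
  obtain ⟨x, y, z, -, h1, -⟩ := sq_int t 1 (-1) 0 (by rw [← h, ε_val]; push_cast; ring)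
  omega

lemma ε_not_neg_sq (t : 𝓞 K) : (ε : 𝓞 K) ≠ - t ^ 2 := by
  intro h
  obtain ⟨x, y, z, -, h1, -⟩ := sq_int t (-1) 1 0 (by
    rw [← neg_neg (t ^ 2), ← h, ε_val]; push_cast; ring)
  omega

lemma unit_form : ∃ η : (𝓞 K)ˣ, ∀ u : (𝓞 K)ˣ, ∃ k : ℤ, u = η ^ k ∨ u = - η ^ k := by
  have hr := rank_one
  refine ⟨Units.fundSystem K ⟨0, by omega⟩, fun u => ?_⟩
  obtain ⟨⟨ζ, e⟩, he, -⟩ := Units.exist_unique_eq_mul_prod K u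
  refine ⟨e ⟨0, by omega⟩, ?_⟩
  have hp : ∏ i, (Units.fundSystem K i) ^ (e i) =
      (Units.fundSystem K ⟨0, by omega⟩) ^ e ⟨0, by omega⟩ := by
    apply Fintype.prod_eq_single
    intro i hi
    exfalso; apply hi; ext; have := i.2; simp; omega
  simp only [hp] at he
  have hodd : Odd (Module.finrank ℚ K) := by rw [finrank_K]; decide
  rcases Units.torsion_eq_one_or_neg_one_of_odd_finrank hodd ζ with h | h
  · left; simpa [h] using he
  · right; simpa [h] using he

lemma unit_class (u : (𝓞 K)ˣ) : ∃ w : (𝓞 K)ˣ,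
    u = w ^ 2 ∨ u = - w ^ 2 ∨ u = ε * w ^ 2 ∨ u = - (ε * w ^ 2) := by
  obtain ⟨η, h⟩ := unit_form
  obtain ⟨j, hj⟩ := h ε
  obtain ⟨k, hk⟩ := h u
  have hjodd : Odd j := by
    rw [← Int.not_even_iff_odd]
    rintro ⟨l, rfl⟩
    have e : η ^ (l + l) = (η ^ l) ^ 2 := by rw [zpow_add, sq]
    rw [e] at hj
    rcases hj with hj | hj
    · exact ε_not_sq (η ^ l : (𝓞 K)ˣ) (by rw [hj]; simp)
    · exact ε_not_neg_sq (η ^ l : (𝓞 K)ˣ) (by rw [hj]; simp)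
  rcases Int.even_or_odd k with ⟨l, rfl⟩ | hko
  · refine ⟨η ^ l, ?_⟩
    have e : η ^ (l + l) = (η ^ l) ^ 2 := by rw [zpow_add, sq]
    rw [e] at hk
    tauto
  · obtain ⟨l, hl⟩ := hko.sub_odd hjodd
    refine ⟨η ^ l, ?_⟩
    have e : η ^ k = η ^ j * (η ^ l) ^ 2 := by
      rw [sq, ← zpow_add, ← zpow_add]; congr 1; omega
    rw [e] at hk
    rcases hj with hj | hj <;> rw [hj] <;> rcases hk with hk | hk <;> rw [hk] <;> simp

lemma coprime_ring {Q : Type*} [CommRing Q] (t : Q) (ht : t ^ 3 = 2 * t ^ 2 - 2)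
    (m F N : ℤ) (hodd : Odd m) (hmF : IsCoprime m F)
    (h : N ^ 2 = m ^ 3 - 4 * m ^ 2 * F + 16 * F ^ 3)
    (hα : (m : Q) - 2 * t * F = 0)
    (hβ : (m : Q) ^ 2 + (2 * t - 4) * m * F + (4 * t ^ 2 - 8 * t) * F ^ 2 = 0) : (1 : Q) = 0 := by
  have hQ : ((N : Q)) ^ 2 = m ^ 3 - 4 * m ^ 2 * F + 16 * F ^ 3 := by exact_mod_cast congrArg (Int.cast (R := Q)) h
  have hN : (N : Q) ^ 2 = 0 := by
    rw [hQ]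
    linear_combination (8 * F ^ 3 : Q) * ht +
      ((m : Q) ^ 2 + (2 * t - 4) * m * F + (4 * t ^ 2 - 8 * t) * F ^ 2) * hα
  have c1 : IsCoprime (N ^ 2) F := by
    rw [h]
    have : IsCoprime (m ^ 3) F := hmF.pow_left
    have h2 := this.add_mul_right_left (- 4 * m ^ 2 + 16 * F ^ 2)
    have e : m ^ 3 - 4 * m ^ 2 * F + 16 * F ^ 3 = m ^ 3 + (- 4 * m ^ 2 + 16 * F ^ 2) * F := by ring
    rw [e]; exact h2
  have c2 : IsCoprime (N ^ 2) 2 := by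
    obtain ⟨l, hl⟩ := hodd
    refine ⟨1, - (4 * l ^ 3 + 6 * l ^ 2 + 3 * l - 2 * m ^ 2 * F + 8 * F ^ 3), ?_⟩
    rw [h, hl]; ring
  have c3 : IsCoprime (N ^ 2) (2 * F) := c2.mul_right c1
  obtain ⟨a, b, hab⟩ := c3
  have hb : (b : Q) * (2 * F) = 1 := by
    have : (a : Q) * N ^ 2 + b * (2 * F) = 1 := by exact_mod_cast congrArg (Int.cast (R := Q)) hab
    linear_combination this - a * hN
  have e1 : (2 * F : Q) ^ 2 * (t * (3 * t - 4)) = 0 := by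
    linear_combination hβ - ((m : Q) + 4 * t * F - 4 * F) * hα
  have e2 : t * (3 * t - 4) = 0 := by
    linear_combination (b : Q) ^ 2 * e1 - (t * (3 * t - 4)) * ((b : Q) * (2 * F) + 1) * hb
  have e3 : (2 : Q) * (3 * t - 4) = 0 := by
    linear_combination (3 * t - 4) * ht - (t ^ 2 - 2 * t) * e2
  have e4 : 3 * t - 4 = 0 := by
    linear_combination (b * F : Q) * e3 - (3 * t - 4) * hb
  have e22 : (22 : Q) = 0 := by
    linear_combination 27 * ht - ((3 * t - 4) ^ 2 + 6 * (3 * t - 4)) * e4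
  have e11 : (11 : Q) = 0 := by
    linear_combination (b * F : Q) * e22 - 11 * hb
  by_cases h11 : (11 : ℤ) ∣ N
  · obtain ⟨N', rfl⟩ := h11
    have hp : Prime (11 : ℤ) := by norm_num
    have hF : ¬ (11 : ℤ) ∣ F := by
      intro hF
      have h2 : (11 : ℤ) ∣ m ^ 3 := by
        obtain ⟨F', rfl⟩ := hF
        exact ⟨11 * N' ^ 2 + 4 * m ^ 2 * F' - 16 * 11 ^ 2 * F' ^ 3, by linear_combination -h⟩
      exact hp.not_isUnit (hmF.isUnit_of_dvd' (hp.dvd_of_dvd_pow h2) hF)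
    have hd : (11 : ℤ) ∣ (m - 10 * F) ^ 2 * (m - 6 * F) :=
      ⟨11 * N' ^ 2 - 2 * m ^ 2 * F + 20 * m * F ^ 2 - 56 * F ^ 3, by linear_combination -h⟩
    rcases hp.dvd_or_dvd hd with hd | hd
    · exfalso
      obtain ⟨k, hk⟩ := hp.dvd_of_dvd_pow hd
      have hm : m = 10 * F + 11 * k := by linarith
      subst hm
      have : (11 : ℤ) ∣ 56 * F ^ 3 := by
        refine ⟨N' ^ 2 - (20 * k * F ^ 2 + 11 * k ^ 3 + 26 * k ^ 2 * F), ?_⟩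
        linarith
      rcases hp.dvd_or_dvd this with h5 | h5
      · norm_num at h5
      · exact hF (hp.dvd_of_dvd_pow h5)
    · obtain ⟨k, hk⟩ := hd
      have hm : (m : Q) = 6 * F + 11 * k := by
        have : m = 6 * F + 11 * k := by linarith
        rw [this]; push_cast; ring
      have e5 : (2 * F : Q) * (3 - t) = 0 := by linear_combination hα - hm + k * e11 - 2 * k * e11 + k * e11 - k * e11
      have e6 : 3 - t = 0 := by linear_combination (b : Q) * e5 - (3 - t) * hb
      linear_combination e11 - 2 * (e4 + 3 * e6)
  · have hp : Prime (11 : ℤ) := by norm_num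
    have : IsCoprime (11 : ℤ) (N ^ 2) := ((Prime.coprime_iff_not_dvd hp).2 h11).pow_right
    obtain ⟨c, d, hcd⟩ := this
    have : (c : Q) * 11 + d * N ^ 2 = 1 := by exact_mod_cast congrArg (Int.cast (R := Q)) hcd
    linear_combination c * e11 + d * hN - this

/-- coprimality of the two factors -/
lemma coprime_factors (m F N : ℤ) (hodd : Odd m) (hmF : IsCoprime m F)
    (h : N ^ 2 = m ^ 3 - 4 * m ^ 2 * F + 16 * F ^ 3) :
    IsCoprime ((m : 𝓞 K) - 2 * θ * F)
      ((m : 𝓞 K) ^ 2 + (2 * θ - 4) * m * F + (4 * θ ^ 2 - 8 * θ) * F ^ 2) := by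
  set α := (m : 𝓞 K) - 2 * θ * F with hα
  set β := (m : 𝓞 K) ^ 2 + (2 * θ - 4) * m * F + (4 * θ ^ 2 - 8 * θ) * F ^ 2 with hβ
  let J := Ideal.span {α, β}
  have hαJ : Ideal.Quotient.mk J α = 0 :=
    Ideal.Quotient.eq_zero_iff_mem.2 (Ideal.subset_span (by simp))
  have hβJ : Ideal.Quotient.mk J β = 0 :=
    Ideal.Quotient.eq_zero_iff_mem.2 (Ideal.subset_span (by simp))
  have key : (1 : 𝓞 K ⧸ J) = 0 := by
    refine coprime_ring (Ideal.Quotient.mk J θ) ?_ m F N hodd hmF h ?_ ?_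
    · have := congrArg (Ideal.Quotient.mk J) θ_eq
      simpa only [map_sub, map_mul, map_pow, map_ofNat] using this
    · simpa only [hα, map_sub, map_add, map_mul, map_pow, map_ofNat, map_intCast] using hαJ
    · simpa only [hβ, map_sub, map_add, map_mul, map_pow, map_ofNat, map_intCast] using hβJ
  rw [← map_one (Ideal.Quotient.mk J), Ideal.Quotient.eq_zero_iff_mem] at key
  exact Ideal.mem_span_pair.1 key

lemma square_class (m F N : ℤ) (hodd : Odd m) (hmF : IsCoprime m F)
    (h : N ^ 2 = m ^ 3 - 4 * m ^ 2 * F + 16 * F ^ 3) :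
    ∃ x y z : ℤ, m = x ^ 2 - 4 * y * z - 4 * z ^ 2 ∧ - F = x * y - z ^ 2 ∧
      (y + 2 * z) ^ 2 = - 2 * x * z := by
  have hN0 : 0 < N ^ 2 := by
    have : N ≠ 0 := by
      rintro rfl
      have h2 : Even (m ^ 3) := ⟨2 * m ^ 2 * F - 8 * F ^ 3, by linarith⟩
      exact (Int.not_even_iff_odd.2 hodd) (Int.even_pow.1 h2).1
    positivity
  have hprod : ((m : 𝓞 K) - 2 * θ * F) *
      ((m : 𝓞 K) ^ 2 + (2 * θ - 4) * m * F + (4 * θ ^ 2 - 8 * θ) * F ^ 2) = (N : 𝓞 K) ^ 2 := by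
    have : ((N : 𝓞 K)) ^ 2 = m ^ 3 - 4 * m ^ 2 * F + 16 * F ^ 3 := by exact_mod_cast h
    rw [this]
    linear_combination (-8 * F ^ 3 : 𝓞 K) * θ_eq
  obtain ⟨d, u, hu⟩ := exists_associated_pow_of_mul_eq_pow' (coprime_factors m F N hodd hmF h) hprod
  obtain ⟨w, hw⟩ := unit_class u
  have hodd' : m % 2 = 1 := Int.odd_iff.1 hodd
  rcases hw with rfl | rfl | rfl | rfl
  · obtain ⟨x, y, z, h1, h2, h3⟩ := sq_int (d * w) m (-2 * F) 0 (by
      push_cast at hu ⊢; linear_combination hu)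
    exact ⟨x, y, z, h1, by linarith, by linarith⟩
  · obtain ⟨x, y, z, h1, h2, h3⟩ := sq_int (d * w) (-m) (2 * F) 0 (by
      push_cast at hu ⊢; linear_combination -hu)
    exfalso
    have h1' : m = - (x ^ 2 - 4 * y * z - 4 * z ^ 2) := by linarith
    have h2' : F = x * y - z ^ 2 := by linarith
    have h3' : y ^ 2 + 2 * x * z + 4 * y * z + 4 * z ^ 2 = 0 := h3.symm
    have hn : N ^ 2 + (x ^ 3 + 2 * x ^ 2 * y + 4 * x ^ 2 * z + 6 * x * y * z + 8 * x * z ^ 2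
        - 2 * y ^ 3 - 4 * y ^ 2 * z + 4 * z ^ 3) ^ 2 = 0 := by
      rw [h, h1', h2']
      set A := x ^ 2 - 4 * y * z - 4 * z ^ 2 with hA
      set B := 2 * (x * y - z ^ 2) with hB
      set C := y ^ 2 + 2 * x * z + 4 * y * z + 4 * z ^ 2 with hC
      have : (4 * A ^ 2 + 6 * A * B + 8 * A * C - 4 * B ^ 2 + 4 * C ^ 2) * C = 0 := by
        rw [h3', mul_zero]
      rw [hA, hB, hC] at this
      rw [hA]
      linear_combination this
    nlinarith [sq_nonneg (x ^ 3 + 2 * x ^ 2 * y + 4 * x ^ 2 * z + 6 * x * y * z + 8 * x * z ^ 2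
        - 2 * y ^ 3 - 4 * y ^ 2 * z + 4 * z ^ 3)]
  · obtain ⟨x, y, z, h1, h2, h3⟩ := sq_int (d * w) (-m + 4 * F) (2 * F - m) (m - 2 * F) (by
      have e := ε.inv_val
      change (θ ^ 2 - θ - 1) * (ε : 𝓞 K) = 1 at e
      push_cast at hu ⊢; linear_combination (θ ^ 2 - θ - 1) * hu - d ^ 2 * w ^ 2 * e - 2 * F * θ_eq)
    omega
  · obtain ⟨x, y, z, h1, h2, h3⟩ := sq_int (d * w) (m - 4 * F) (m - 2 * F) (2 * F - m) (by
      have e := ε.inv_val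
      change (θ ^ 2 - θ - 1) * (ε : 𝓞 K) = 1 at e
      push_cast at hu ⊢; linear_combination - (θ ^ 2 - θ - 1) * hu - d ^ 2 * w ^ 2 * e + 2 * F * θ_eq)
    omega

/-- descent -/
lemma descent :
    ∀ (n : ℕ) (f m N : ℤ), f.natAbs = n → f ≠ 0 → Odd m → IsCoprime m f →
      N ^ 2 = m ^ 3 - 4 * m ^ 2 * f ^ 2 + 16 * f ^ 6 → False := by
  intro n
  induction n using Nat.strong_induction_on with
  | _ n ih =>
  intro f m N hn hf0 hodd hmf h
  obtain ⟨x, y, z, h1, h2, h3, hx⟩ : ∃ x y z : ℤ, m = x ^ 2 - 4 * y * z - 4 * z ^ 2 ∧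
      - f ^ 2 = x * y - z ^ 2 ∧ (y + 2 * z) ^ 2 = - 2 * x * z ∧ 0 ≤ x := by
    obtain ⟨x, y, z, h1, h2, h3⟩ := square_class m (f ^ 2) N hodd hmf.pow_right (by linear_combination h)
    rcases le_total 0 x with hx | hx
    · exact ⟨x, y, z, h1, h2, h3, hx⟩
    · exact ⟨-x, -y, -z, by linear_combination h1, by linear_combination h2,
        by linear_combination h3, by linarith⟩
  have hxodd : Odd x := by
    rw [← Int.not_even_iff_odd] at hodd ⊢
    rintro ⟨k, hk⟩
    apply hodd
    exact ⟨2 * k ^ 2 - 2 * y * z - 2 * z ^ 2, by rw [h1, hk]; ring⟩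
  have hxz : IsCoprime x z := by
    rw [Int.isCoprime_iff_gcd_eq_one]
    by_contra hne
    obtain ⟨p, hp, hpd⟩ := Nat.exists_prime_and_dvd hne
    have hp' : Prime (p : ℤ) := Nat.prime_iff_prime_int.1 hp
    have hpx : (p : ℤ) ∣ x := (Int.natCast_dvd_natCast.2 hpd).trans (Int.gcd_dvd_left ..)
    have hpz : (p : ℤ) ∣ z := (Int.natCast_dvd_natCast.2 hpd).trans (Int.gcd_dvd_right ..)
    have hpm : (p : ℤ) ∣ m := by
      rw [h1]
      exact dvd_sub (dvd_sub (hpx.pow two_ne_zero) (hpz.mul_left _)) ((hpz.pow two_ne_zero).mul_left _)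
    have hpf : (p : ℤ) ∣ f ^ 2 := by
      rw [← dvd_neg, h2]
      exact dvd_sub (hpx.mul_right _) (hpz.pow two_ne_zero)
    exact hp'.not_isUnit (hmf.isUnit_of_dvd' hpm (hp'.dvd_of_dvd_pow hpf))
  have hx2 : IsCoprime x 2 := by
    obtain ⟨k, hk⟩ := hxodd
    exact ⟨1, -k, by rw [hk]; ring⟩
  have hx0 : 0 < x := by
    rcases hx.lt_or_eq with h0 | h0
    · exact h0
    · rw [← h0] at hxodd; exact absurd hxodd (by decide)
  have hc : IsCoprime x (-(2 * z)) := (hx2.mul_right hxz).neg_right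
  have hsq : x * (-(2 * z)) = (y + 2 * z) ^ 2 := by rw [h3]; ring
  obtain ⟨r, hr⟩ : ∃ r, x = r ^ 2 := by
    obtain ⟨r, hr | hr⟩ := Int.sq_of_isCoprime hc hsq
    · exact ⟨r, hr⟩
    · nlinarith [sq_nonneg r]
  obtain ⟨k, hk⟩ : ∃ k, -(2 * z) = k ^ 2 := by
    obtain ⟨k, hk | hk⟩ := Int.sq_of_isCoprime hc.symm (by rw [mul_comm]; exact hsq)
    · exact ⟨k, hk⟩
    · refine ⟨0, ?_⟩
      have h5 : 0 ≤ x * (-(2 * z)) := by rw [hsq]; positivity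
      have h6 := nonneg_of_mul_nonneg_right h5 hx0
      nlinarith [sq_nonneg k]
  have hke : Even k := by
    have : Even (k ^ 2) := ⟨-z, by linarith⟩
    exact (Int.even_pow.1 this).1
  obtain ⟨q', hq'⟩ := hke
  have hz' : z = -2 * q' ^ 2 := by rw [hq'] at hk; linarith
  obtain ⟨q, hz, hy⟩ : ∃ q, z = -2 * q ^ 2 ∧ y = 2 * r * q + 4 * q ^ 2 := by
    have : (y + 2 * z) ^ 2 = (2 * r * q') ^ 2 := by rw [h3, hr, hz']; ring
    rcases sq_eq_sq_iff_eq_or_eq_neg.1 this with h5 | h5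
    · exact ⟨q', hz', by linarith⟩
    · exact ⟨-q', by linarith, by linarith⟩
  have hf2 : (-(2 * q)) * (r ^ 3 + 2 * r ^ 2 * q - 2 * q ^ 3) = f ^ 2 := by
    rw [hz, hy, hr] at h2; linear_combination h2
  have hrodd : Odd r := by rw [hr] at hxodd; exact (Int.odd_pow.1 hxodd).resolve_right two_ne_zero
  have hrq : IsCoprime r q := by
    rw [hr, hz] at hxz
    exact (IsCoprime.pow_iff (by norm_num) (by norm_num)).1 hxz.of_mul_right_right
  have hr2 : IsCoprime r 2 := by
    obtain ⟨k, hk⟩ := hrodd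
    exact ⟨1, -k, by rw [hk]; ring⟩
  have hc2 : IsCoprime (-(2 * q)) (r ^ 3 + 2 * r ^ 2 * q - 2 * q ^ 3) := by
    have h5 : IsCoprime (r ^ 3) (2 * q) := (hr2.mul_right hrq).pow_left
    have h6 := (h5.add_mul_left_left (r ^ 2 - q ^ 2)).symm.neg_left
    have e : r ^ 3 + 2 * r ^ 2 * q - 2 * q ^ 3 = r ^ 3 + 2 * q * (r ^ 2 - q ^ 2) := by ring
    rw [e]; exact h6
  have hfpos : 0 < f ^ 2 := by positivity
  have fin : ∀ h' b r' : ℤ, IsCoprime r' h' → Odd r' → f ^ 2 = (2 * h') ^ 2 * b ^ 2 →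
      b ^ 2 = r' ^ 3 - 4 * r' ^ 2 * h' ^ 2 + 16 * h' ^ 6 → False := by
    intro h' b r' hc hro hff hb
    have hb0 : b ≠ 0 := by rintro rfl; simp at hff; exact hf0 hff
    have hh0 : h' ≠ 0 := by rintro rfl; simp at hff; exact hf0 hff
    refine ih h'.natAbs ?_ h' r' b rfl hh0 hro hc hb
    rw [← hn, Int.natAbs_lt_iff_sq_lt, hff]
    have : 0 < h' ^ 2 := by positivity
    have : 0 < b ^ 2 := by positivity
    nlinarith
  have hev : ∀ a : ℤ, Even (a ^ 2) → ∃ h', a = 2 * h' := fun a ha => by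
    obtain ⟨t, ht⟩ := (Int.even_pow.1 ha).1
    exact ⟨t, by linarith⟩
  obtain ⟨a, ha⟩ := Int.sq_of_isCoprime hc2 hf2
  obtain ⟨b, hb⟩ := Int.sq_of_isCoprime hc2.symm (by rw [mul_comm]; exact hf2)
  rcases ha with ha | ha <;> rcases hb with hb | hb
  · obtain ⟨h', rfl⟩ := hev a ⟨-q, by linarith⟩
    have hq : q = -2 * h' ^ 2 := by linarith
    refine fin h' b r ?_ hrodd (by rw [← hf2, ha, hb]) (by rw [← hb, hq]; ring)
    rw [hq] at hrq
    exact (IsCoprime.pow_right_iff (by norm_num)).1 hrq.of_mul_right_right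
  · rw [ha, hb] at hf2; nlinarith [mul_nonneg (sq_nonneg a) (sq_nonneg b)]
  · rw [ha, hb] at hf2; nlinarith [mul_nonneg (sq_nonneg a) (sq_nonneg b)]
  · obtain ⟨h', rfl⟩ := hev a ⟨q, by linarith⟩
    have hq : q = 2 * h' ^ 2 := by linarith
    refine fin h' b (-r) ?_ hrodd.neg (by rw [← hf2, ha, hb]; ring) (by
      have : b ^ 2 = - (r ^ 3 + 2 * r ^ 2 * q - 2 * q ^ 3) := by linarith
      rw [this, hq]; ring)
    rw [hq] at hrq
    exact ((IsCoprime.pow_right_iff (by norm_num)).1 hrq.of_mul_right_right).neg_left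

/-- no rational point on the elliptic curve has `x` with even denominator -/
lemma den_odd (x y : ℚ) (h : y ^ 2 + y = x ^ 3 - x ^ 2) : ¬ Even x.den := by
  intro hev
  have hDpos : 0 < x.den := x.den_pos
  have hcop : IsCoprime x.num (x.den : ℤ) := by
    rw [Int.isCoprime_iff_gcd_eq_one]; exact x.reduced
  have hxe : x = (x.num : ℚ) / (x.den : ℤ) := by
    rw [Int.cast_natCast]; exact (Rat.num_div_den x).symm
  generalize x.num = m at *
  have hev' : Even (x.den : ℤ) := by exact_mod_cast hev
  have hDpos' : 0 < (x.den : ℤ) := by exact_mod_cast hDpos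
  generalize (x.den : ℤ) = D at *
  obtain ⟨D', hD'⟩ := hev'
  have hmodd : Odd m := by
    rw [← Int.not_even_iff_odd]
    rintro ⟨k, hk⟩
    have := hcop.isUnit_of_dvd' (x := 2) ⟨k, by linarith⟩ ⟨D', by linarith⟩
    exact Int.prime_two.not_isUnit this
  have hDq : (D : ℚ) ≠ 0 := by exact_mod_cast hDpos'.ne'
  have hsq : IsSquare ((D * (4 * m ^ 3 - 4 * m ^ 2 * D + D ^ 3) : ℤ) : ℚ) := by
    refine ⟨(2 * y + 1) * D ^ 2, ?_⟩
    have h4 : (2 * y + 1) ^ 2 = 4 * x ^ 3 - 4 * x ^ 2 + 1 := by linear_combination 4 * h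
    have : ((2 * y + 1) * (D : ℚ) ^ 2) * ((2 * y + 1) * D ^ 2) = (2 * y + 1) ^ 2 * D ^ 4 := by ring
    rw [this, h4, hxe]
    push_cast
    field_simp
  rw [Rat.isSquare_intCast_iff] at hsq
  obtain ⟨W, hW⟩ := hsq
  have hev2 : ∀ a : ℤ, Even (a ^ 2) → ∃ h', a = 2 * h' := fun a ha => by
    obtain ⟨t, ht⟩ := (Int.even_pow.1 ha).1
    exact ⟨t, by linarith⟩
  rw [hD'] at hW
  obtain ⟨W1, rfl⟩ := hev2 W
    ⟨4 * D' * (m ^ 3 - 2 * m ^ 2 * D' + 2 * D' ^ 3), by linear_combination -hW⟩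
  have hW1 : W1 ^ 2 = 2 * D' * (m ^ 3 - 2 * m ^ 2 * D' + 2 * D' ^ 3) := by linarith
  obtain ⟨W2, rfl⟩ := hev2 W1
    ⟨D' * (m ^ 3 - 2 * m ^ 2 * D' + 2 * D' ^ 3), by linarith⟩
  have hW2 : 2 * W2 ^ 2 = D' * (m ^ 3 - 2 * m ^ 2 * D' + 2 * D' ^ 3) := by linarith
  have ho : Odd (m ^ 3 - 2 * m ^ 2 * D' + 2 * D' ^ 3) := by
    have e : m ^ 3 - 2 * m ^ 2 * D' + 2 * D' ^ 3 = m ^ 3 + 2 * (D' ^ 3 - m ^ 2 * D') := by ring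
    rw [e]
    exact hmodd.pow.add_even (even_two_mul _)
  have hD'e : Even D' := by
    have : Even (D' * (m ^ 3 - 2 * m ^ 2 * D' + 2 * D' ^ 3)) := ⟨W2 ^ 2, by linarith⟩
    rcases Int.even_mul.1 this with h1 | h1
    · exact h1
    · exact absurd h1 (Int.not_even_iff_odd.2 ho)
  obtain ⟨E, hE⟩ := hD'e
  have hD4 : D = 4 * E := by linarith
  subst hE
  have hU : E * (m ^ 3 - 4 * m ^ 2 * E + 16 * E ^ 3) = W2 ^ 2 := by linarith
  have hmE : IsCoprime m E := by rw [hD4] at hcop; exact hcop.of_mul_right_right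
  have hEpos : 0 < E := by linarith
  have ho' : Odd (m ^ 3 - 4 * m ^ 2 * E + 16 * E ^ 3) := by
    have e : m ^ 3 - 4 * m ^ 2 * E + 16 * E ^ 3 = m ^ 3 + 2 * (8 * E ^ 3 - 2 * m ^ 2 * E) := by ring
    rw [e]
    exact hmodd.pow.add_even (even_two_mul _)
  have hc : IsCoprime E (m ^ 3 - 4 * m ^ 2 * E + 16 * E ^ 3) := by
    have h5 : IsCoprime (m ^ 3) E := hmE.pow_left
    have h6 := (h5.add_mul_left_left (16 * E ^ 2 - 4 * m ^ 2)).symm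
    have e : m ^ 3 - 4 * m ^ 2 * E + 16 * E ^ 3 = m ^ 3 + E * (16 * E ^ 2 - 4 * m ^ 2) := by ring
    rw [e]; exact h6
  obtain ⟨f, hf⟩ := Int.sq_of_isCoprime hc hU
  obtain ⟨N, hN⟩ := Int.sq_of_isCoprime hc.symm (by rw [mul_comm]; exact hU)
  have hf : E = f ^ 2 := by
    rcases hf with hf | hf
    · exact hf
    · nlinarith [sq_nonneg f]
  have hN : m ^ 3 - 4 * m ^ 2 * E + 16 * E ^ 3 = N ^ 2 := by
    have h0 : 0 ≤ m ^ 3 - 4 * m ^ 2 * E + 16 * E ^ 3 :=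
      nonneg_of_mul_nonneg_right (by rw [hU]; positivity) hEpos
    rcases hN with hN | hN
    · exact hN
    · nlinarith [sq_nonneg N]
  have hf0 : f ≠ 0 := by rintro rfl; norm_num at hf; omega
  rw [hf] at hN hmE
  exact descent _ f m N rfl hf0 hmodd ((IsCoprime.pow_right_iff (by norm_num)).1 hmE)
    (by linear_combination -hN)

lemma den_even_of {r : ℚ} (A B : ℤ) (hA : Odd A) (hB : Even B) (hB0 : B ≠ 0)
    (h : r = A / B) : Even r.den := by
  have h1 : r = (r.num : ℚ) / r.den := (Rat.num_div_den r).symm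
  have hd : (r.den : ℚ) ≠ 0 := by exact_mod_cast r.den_nz
  have hBq : (B : ℚ) ≠ 0 := by exact_mod_cast hB0
  have h2 : A * (r.den : ℤ) = r.num * B := by
    rw [h1] at h
    have : (A : ℚ) * r.den = r.num * B := by
      rw [div_eq_div_iff hd hBq] at h; linarith
    exact_mod_cast this
  have h3 : Even (A * (r.den : ℤ)) := by rw [h2]; exact hB.mul_left _
  rcases Int.even_mul.1 h3 with h4 | h4
  · exact absurd h4 (Int.not_even_iff_odd.2 hA)
  · exact_mod_cast h4

lemma ec_aux (x y : ℚ) (h : y ^ 2 + y = x ^ 3 - x ^ 2) (m D p q : ℤ)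
    (hD : Odd D) (hq : Odd q) (hp : Odd p) (hx : x = m / D) (hy : y = p / q) :
    x = 0 ∨ x = 1 := by
  by_contra hcon
  push Not at hcon
  obtain ⟨hx0, hx1⟩ := hcon
  have hD0 : D ≠ 0 := by rintro rfl; exact absurd hD (by decide)
  have hq0 : q ≠ 0 := by rintro rfl; exact absurd hq (by decide)
  have hDq : (D : ℚ) ≠ 0 := by exact_mod_cast hD0
  have hqq : (q : ℚ) ≠ 0 := by exact_mod_cast hq0
  rcases Int.even_or_odd m with hm | hm
  · have hm0 : m ≠ 0 := by rintro rfl; simp at hx; exact hx0 hx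
    have hmq : (m : ℚ) ≠ 0 := by exact_mod_cast hm0
    obtain ⟨l, hl⟩ : ∃ l, l = y / x := ⟨_, rfl⟩
    have hyl : y = l * x := by rw [hl]; field_simp
    have hk : l ^ 2 * x + l = x ^ 2 - x := by
      apply mul_left_cancel₀ hx0
      rw [hyl] at h; linear_combination h
    refine den_odd (l ^ 2 + 1 - x) (l * (l ^ 2 + 1 - x))
      (by linear_combination (l ^ 2 + 1 - x) * hk) ?_
    refine den_even_of (p ^ 2 * D ^ 3 + q ^ 2 * m ^ 2 * (D - m)) (q ^ 2 * m ^ 2 * D) ?_ ?_ ?_ ?_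
    · refine (hp.pow.mul hD.pow).add_even ?_
      exact ((hm.pow_of_ne_zero two_ne_zero).mul_left _).mul_right _
    · exact ((hm.pow_of_ne_zero two_ne_zero).mul_left _).mul_right _
    · positivity
    · rw [hl, hx, hy]; push_cast; field_simp; ring
  · have hm1 : (m : ℚ) - D ≠ 0 := by
      intro h0
      apply hx1; rw [hx, sub_eq_zero.1 h0, div_self hDq]
    have hm1' : m - D ≠ 0 := by
      intro h0; apply hm1; exact_mod_cast h0
    have hx1' : x - 1 ≠ 0 := sub_ne_zero.2 hx1
    obtain ⟨l, hl⟩ : ∃ l, l = y / (x - 1) := ⟨_, rfl⟩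
    have hyl : y = l * (x - 1) := by rw [hl]; field_simp
    have hk : l ^ 2 * (x - 1) + l = x ^ 2 := by
      apply mul_left_cancel₀ hx1'
      rw [hyl] at h; linear_combination h
    refine den_odd (l ^ 2 - x) (l * (l ^ 2 - x - 1))
      (by linear_combination (l ^ 2 - x - 1) * hk) ?_
    have hmD : Even (m - D) := hm.sub_odd hD
    refine den_even_of (p ^ 2 * D ^ 3 - m * q ^ 2 * (m - D) ^ 2) (q ^ 2 * (m - D) ^ 2 * D) ?_ ?_ ?_ ?_
    · refine (hp.pow.mul hD.pow).sub_even ?_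
      exact (hmD.pow_of_ne_zero two_ne_zero).mul_left _
    · exact ((hmD.pow_of_ne_zero two_ne_zero).mul_left _).mul_right _
    · positivity
    · have : x - 1 = (m - D) / D := by rw [hx]; field_simp
      rw [hl, this, hx, hy]; push_cast; field_simp

/-- the affine rational points of `11a3` have `x = 0` or `x = 1` -/
lemma ec (x y : ℚ) (h : y ^ 2 + y = x ^ 3 - x ^ 2) : x = 0 ∨ x = 1 := by
  have hD : Odd (x.den : ℤ) := by
    have := Nat.not_even_iff_odd.1 (den_odd x y h)
    exact_mod_cast this
  have hx : x = (x.num : ℚ) / (x.den : ℤ) := by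
    rw [Int.cast_natCast]; exact (Rat.num_div_den x).symm
  have hy : y = (y.num : ℚ) / (y.den : ℤ) := by
    rw [Int.cast_natCast]; exact (Rat.num_div_den y).symm
  have hd : ((x.den : ℤ) : ℚ) ≠ 0 := by exact_mod_cast x.den_nz
  have hd' : ((y.den : ℤ) : ℚ) ≠ 0 := by exact_mod_cast y.den_nz
  have hcop : IsCoprime y.num (y.den : ℤ) := by
    rw [Int.isCoprime_iff_gcd_eq_one]; exact y.reduced
  generalize x.num = m at *
  generalize (x.den : ℤ) = D at *
  generalize y.num = p at *
  generalize (y.den : ℤ) = q at *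
  have hz : p * (p + q) * D ^ 3 = m ^ 2 * (m - D) * q ^ 2 := by
    rw [hx, hy] at h
    field_simp at h
    have : ((p * (p + q) * D ^ 3 : ℤ) : ℚ) = (m ^ 2 * (m - D) * q ^ 2 : ℤ) := by
      push_cast; linear_combination h
    exact_mod_cast this
  have hq : Odd q := by
    rw [← Int.not_even_iff_odd]
    intro hqe
    have hpo : Odd p := by
      rw [← Int.not_even_iff_odd]
      intro hpe
      exact Int.prime_two.not_isUnit (hcop.isUnit_of_dvd' hpe.two_dvd hqe.two_dvd)
    have h1 : Odd (p * (p + q) * D ^ 3) := (hpo.mul (hpo.add_even hqe)).mul hD.pow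
    rw [hz] at h1
    exact (Int.not_even_iff_odd.2 h1) ((hqe.pow_of_ne_zero two_ne_zero).mul_left _)
  rcases Int.even_or_odd p with hp | hp
  · refine ec_aux x (-1 - y) (by linear_combination h) m D (-p - q) q hD hq (hp.neg.sub_odd hq) hx ?_
    rw [hy]; push_cast; field_simp; ring
  · exact ec_aux x y h m D p q hD hq hp hx hy

end N3E2


/-- The only rational points on `a²t² - a²t + 2at² + t² - a = 0`
are `(0, 0)` and `(-1, 1)` (graph N3E2). -/
theorem stmt_4 :
    {p : ℚ × ℚ |
        p.1 ^ 2 * p.2 ^ 2 - p.1 ^ 2 * p.2 + 2 * p.1 * p.2 ^ 2 + p.2 ^ 2 - p.1 = 0} =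
      ({(0, 0), (-1, 1)} : Set (ℚ × ℚ)) := by
  ext ⟨a, t⟩
  simp only [Set.mem_ofPred_eq, Set.mem_insert_iff, Set.mem_singleton_iff, Prod.mk.injEq]
  constructor
  · intro h
    by_cases ha : a = 0
    · subst ha
      left
      refine ⟨rfl, ?_⟩
      have : t ^ 2 = 0 := by linear_combination h
      exact pow_eq_zero_iff two_ne_zero |>.1 this
    · right
      have h1 : (-((a + 1) / a) ^ 2 * t) ^ 2 + (-((a + 1) / a) ^ 2 * t)
          = ((a + 1) / a) ^ 3 - ((a + 1) / a) ^ 2 := by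
        field_simp
        linear_combination (a + 1) ^ 2 * h
      rcases N3E2.ec _ _ h1 with h2 | h2
      · have h3 : a = -1 := by
          rw [div_eq_zero_iff] at h2
          rcases h2 with h2 | h2
          · linarith
          · exact absurd h2 ha
        subst h3
        exact ⟨rfl, by linarith⟩
      · rw [div_eq_one_iff_eq ha] at h2
        linarith
  · rintro (⟨rfl, rfl⟩ | ⟨rfl, rfl⟩) <;> norm_num
end
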